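/- Let (G, Ω_G) and (F, Ω_F) be two finite holomorphic IFS on ℂ satisfying the strong separation condition, where G = {g_i}_{i∈Λ} and F = {f_j}_{j∈Λ̃}. Then the following are equivalent: (I) G and F share the same attractor A = A_G = A_F; (III) there exist box-like restrictions (G, V_G) of (G, Ω_G) and (F, V_F) of (F, Ω_F), a finite collection of words t^k ∈ Λ*, u^k ∈ Λ̃*, k = 1, …, K, for some K ∈ ℕ, and M ∈ ℕ with M ≥ M* + 1, where M* = max{ |t^k|, |u^k| : k = 1, …, K }, such that: (G-side) for every connected component D of V_G and every t ∈ Λ^M there exist a word u ∈ Λ̃* with |u| ≥ M* + 1 and an index k ∈ {1, …, K} such that g_{t^k}(D ∩ A_G) ⊂ f_{u^k}(V_F) and f_u ∘ f_{u^k}^{-1} = g_t ∘ g_{t^k}^{-1} on g_{t^k}(D ∩ A_G); and (F-side) the same holds after switching the roles of G and F. -/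

import Mathlib

open Set Metric

noncomputable section

/-- A finite holomorphic IFS: a bounded domain `Ω ⊂ ℂ` together with finitely many
univalent maps `g i : Ω → Ω` with `closure (g i '' Ω) ⊆ Ω`. -/
structure HolIFS where
  /-- the number of maps -/
  m : ℕ
  hm : 1 ≤ m
  /-- the domain -/
  Ω : Set ℂ
  hopen : IsOpen Ω
  hconn : IsConnected Ω
  hbdd : Bornology.IsBounded Ω
  /-- the maps of the IFS -/
  g : Fin m → ℂ → ℂ
  hdiff : ∀ i, DifferentiableOn ℂ (g i) Ω
  hinj : ∀ i, Set.InjOn (g i) Ω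
  hcl : ∀ i, closure (g i '' Ω) ⊆ Ω

/-- `A` is the attractor of the IFS `S`: the (unique) nonempty compact subset of `Ω`
with `A = ⋃ i, g i '' A`. -/
def HolIFS.IsAttractor (S : HolIFS) (A : Set ℂ) : Prop :=
  A.Nonempty ∧ IsCompact A ∧ A ⊆ S.Ω ∧ A = ⋃ i, S.g i '' A

/-- The strong separation condition for the IFS `S` with attractor `A`. -/
def HolIFS.SSC (S : HolIFS) (A : Set ℂ) : Prop :=
  ∀ i j : Fin S.m, i ≠ j → Disjoint (S.g i '' A) (S.g j '' A)

/-- For a finite word `w = [i₁, …, i_k]`, the composition `g_w = g i₁ ∘ ⋯ ∘ g i_k`. -/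
def HolIFS.word (S : HolIFS) (w : List (Fin S.m)) : ℂ → ℂ :=
  w.foldr (fun i f => S.g i ∘ f) id

/-- `(S, V)` is a box-like restriction of the IFS `(S, Ω)` with attractor `A`. -/
def HolIFS.IsBoxLike (S : HolIFS) (A V : Set ℂ) : Prop :=
  IsOpen V ∧ V ⊆ S.Ω ∧ A ⊆ V ∧ (∀ i, closure (S.g i '' V) ⊆ V) ∧
  ∀ i j : Fin S.m, i ≠ j → Disjoint (closure (S.g i '' V)) (closure (S.g j '' V))

/-- Condition (G_fin): for the box-like restrictions `(G, V_G)` and `(F, V_F)`, words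
`t^k, u^k` (`k : Fin K`) and `M`, for every component `D` of `V_G` and every word
`t ∈ Λ^M` there are `u ∈ Λ̃*` with `|u| ≥ M* + 1` and `k` such that
`g_{t^k} '' (D ∩ A_G) ⊆ f_{u^k} '' V_F` and `f_u ∘ f_{u^k}⁻¹ = g_t ∘ g_{t^k}⁻¹` on
`g_{t^k} '' (D ∩ A_G)`; here both conditions are encoded pointwise: for
`z ∈ D ∩ A_G` there is `y ∈ V_F` with `f_{u^k} y = g_{t^k} z` and `f_u y = g_t z`. -/
def GFinSide (G F : HolIFS) (Ag VG VF : Set ℂ) (K : ℕ)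
    (tk : Fin K → List (Fin G.m)) (uk : Fin K → List (Fin F.m))
    (Mstar M : ℕ) : Prop :=
  ∀ x ∈ VG, ∀ t : List (Fin G.m), t.length = M →
    ∃ (u : List (Fin F.m)) (k : Fin K), Mstar + 1 ≤ u.length ∧
      ∀ z ∈ connectedComponentIn VG x ∩ Ag, ∃ y ∈ VF,
        F.word (uk k) y = G.word (tk k) z ∧ F.word u y = G.word t z

section Helpers
open Filter Topology

lemma deriv_ne_zero_of_injOn {f : ℂ → ℂ} {U : Set ℂ} (hU : IsOpen U)
    (hf : DifferentiableOn ℂ f U) (hinj : InjOn f U) {a : ℂ} (ha : a ∈ U) : deriv f a ≠ 0 := by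
  intro h0
  have hUa : U ∈ 𝓝 a := hU.mem_nhds ha
  have hfa : AnalyticAt ℂ f a := hf.analyticAt hUa
  have hga : AnalyticAt ℂ (fun z => f z - f a) a := hfa.sub analyticAt_const
  have hne : ¬ ∀ᶠ z in 𝓝 a, f z - f a = 0 := by
    intro h
    have h1 : ∀ᶠ z in 𝓝[≠] a, f z - f a = 0 := h.filter_mono nhdsWithin_le_nhds
    have h2 : ∀ᶠ z in 𝓝[≠] a, z ∈ U := nhdsWithin_le_nhds hUa
    obtain ⟨z, ⟨hz1, hz2⟩, hz3⟩ := ((h1.and h2).and self_mem_nhdsWithin).exists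
    exact hz3 (hinj hz2 ha (sub_eq_zero.1 hz1))
  obtain ⟨n, h, hh, hha, hev⟩ := (hga.exists_eventuallyEq_pow_smul_nonzero_iff).2 hne
  have hn : 2 ≤ n := by
    by_contra hlt
    have : n = 0 ∨ n = 1 := by omega
    rcases this with rfl | rfl
    · have := hev.self_of_nhds
      simp at this
      exact hha this.symm
    · have e1 : (fun z => f z - f a) =ᶠ[𝓝 a] fun z => (z - a) * h z := by
        filter_upwards [hev] with z hz
        simpa using hz
      have e2 : HasDerivAt (fun z => (z - a) * h z) (1 * h a + (a - a) * deriv h a) a :=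
        ((hasDerivAt_id a).sub_const a).mul hh.differentiableAt.hasDerivAt
      have e3 := (e2.congr_of_eventuallyEq e1).deriv
      rw [deriv_sub_const] at e3
      rw [h0] at e3
      simp at e3
      exact hha e3.symm
  set k : ℂ → ℂ := fun z => Complex.exp (Complex.log (h z / h a) / n) with hk
  have hka : AnalyticAt ℂ k a := by
    refine AnalyticAt.cexp (AnalyticAt.div (AnalyticAt.clog (hh.div analyticAt_const hha) ?_) analyticAt_const ?_)
    · rw [div_self hha]; exact Complex.one_mem_slitPlane
    · exact_mod_cast (by omega : n ≠ 0)
  have hn0 : (n : ℂ) ≠ 0 := by exact_mod_cast (by omega : n ≠ 0)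
  have hpa : AnalyticAt ℂ (fun z => (z - a) * k z) a :=
    (analyticAt_id.sub analyticAt_const).mul hka
  have hk1 : k a = 1 := by simp [hk, div_self hha]
  have hpd : HasStrictDerivAt (fun z => (z - a) * k z) 1 a := by
    have e2 : HasDerivAt (fun z => (z - a) * k z) (1 * k a + (a - a) * deriv k a) a :=
        ((hasDerivAt_id a).sub_const a).mul hka.differentiableAt.hasDerivAt
    have := hpa.hasStrictDerivAt
    rw [e2.deriv] at this
    simpa [hk1] using this
  have hmap := hpd.map_nhds_eq one_ne_zero
  simp only [sub_self, zero_mul] at hmap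
  have hhne : ∀ᶠ z in 𝓝 a, h z ≠ 0 := hh.continuousAt.eventually_ne hha
  have hkey : ∀ᶠ z in 𝓝 a, z ∈ U ∧ f z = f a + h a * ((z - a) * k z) ^ n := by
    filter_upwards [hUa, hev, hhne] with z hz hz2 hz3
    refine ⟨hz, ?_⟩
    have : k z ^ n = h z / h a := by
      rw [hk]
      simp only
      rw [← Complex.exp_nat_mul, mul_div_cancel₀ _ hn0, Complex.exp_log (div_ne_zero hz3 hha)]
    rw [mul_pow, this]
    have h5 : f z - f a = (z - a) ^ n * h z := by simpa using hz2
    field_simp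
    linear_combination h5
  have him : (fun z => (z - a) * k z) '' {z | z ∈ U ∧ f z = f a + h a * ((z - a) * k z) ^ n} ∈ 𝓝 (0:ℂ) := by
    rw [← hmap]; exact image_mem_map hkey
  set ζ : ℂ := Complex.exp (2 * Real.pi * Complex.I / n) with hζ
  have hprim : IsPrimitiveRoot ζ n := Complex.isPrimitiveRoot_exp n (by omega)
  have hc : Tendsto (fun w : ℂ => ζ * w) (𝓝 0) (𝓝 0) := by
    have : Continuous (fun w : ℂ => ζ * w) := by fun_prop
    simpa using this.tendsto 0
  have h1 := (hc.eventually him).and him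
  obtain ⟨w, ⟨hw1, hw2⟩, hw3⟩ := ((h1.filter_mono nhdsWithin_le_nhds).and (self_mem_nhdsWithin (a := (0:ℂ)) (s := {0}ᶜ))).exists
  obtain ⟨z1, ⟨hz1, hz1'⟩, e1⟩ := hw1
  obtain ⟨z2, ⟨hz2, hz2'⟩, e2⟩ := hw2
  simp only at e1 e2
  have : z1 = z2 := by
    apply hinj hz1 hz2
    rw [hz1', hz2', e1, e2, mul_pow, hprim.pow_eq_one, one_mul]
  subst this
  rw [e1] at e2
  have hw0 : w ≠ 0 := hw3
  have : ζ = 1 := by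
    have : ζ * w = 1 * w := by rw [e2, one_mul]
    exact mul_right_cancel₀ hw0 this
  exact hprim.ne_one (by omega) this

namespace HolIFS
variable (S : HolIFS)

@[simp] lemma word_nil : S.word [] = id := rfl
@[simp] lemma word_cons (i : Fin S.m) (w : List (Fin S.m)) : S.word (i :: w) = S.g i ∘ S.word w := rfl
lemma word_append (v w : List (Fin S.m)) (z : ℂ) : S.word (v ++ w) z = S.word v (S.word w z) := by
  induction v with
  | nil => rfl
  | cons i v ih => simp [ih]

lemma g_maps (i : Fin S.m) {z : ℂ} (hz : z ∈ S.Ω) : S.g i z ∈ S.Ω :=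
  S.hcl i (subset_closure ⟨z, hz, rfl⟩)

lemma word_maps (w : List (Fin S.m)) {z : ℂ} (hz : z ∈ S.Ω) : S.word w z ∈ S.Ω := by
  induction w with
  | nil => exact hz
  | cons i v ih => exact S.g_maps i ih

lemma word_inj (w : List (Fin S.m)) : InjOn (S.word w) S.Ω := by
  induction w with
  | nil => exact injOn_id _
  | cons i v ih =>
    intro x hx y hy h
    exact ih hx hy (S.hinj i (S.word_maps v hx) (S.word_maps v hy) h)

lemma word_diff (w : List (Fin S.m)) : DifferentiableOn ℂ (S.word w) S.Ω := by
  induction w with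
  | nil => exact differentiableOn_id
  | cons i v ih => exact (S.hdiff i).comp ih (fun z hz => S.word_maps v hz)

lemma exists_diam : ∃ D > 0, ∀ x ∈ S.Ω, ∀ y ∈ S.Ω, ‖x - y‖ ≤ D := by
  obtain ⟨D, hD⟩ := (Metric.isBounded_iff.1 S.hbdd)
  refine ⟨max D 1, by positivity, fun x hx y hy => ?_⟩
  have := hD hx hy
  rw [dist_eq_norm] at this
  exact this.trans (le_max_left _ _)

lemma exists_core : ∃ K, IsCompact K ∧ K ⊆ S.Ω ∧ ∀ i, closure (S.g i '' S.Ω) ⊆ K := by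
  refine ⟨⋃ i, closure (S.g i '' S.Ω), isCompact_iUnion fun i => ?_, iUnion_subset S.hcl,
    fun i => subset_iUnion (fun i => closure (S.g i '' S.Ω)) i⟩
  exact (S.hbdd.subset (subset_closure.trans (S.hcl i))).isCompact_closure

lemma deriv_bound : ∃ lam : ℝ, 0 < lam ∧ lam < 1 ∧ ∀ (w : List (Fin S.m)) (h : ℂ → ℂ),
    DifferentiableOn ℂ h S.Ω → (∀ z ∈ S.Ω, ‖h z‖ ≤ 1) → ∀ z r, 0 < r → closedBall z r ⊆ S.Ω →
      ‖deriv (h ∘ S.word w) z‖ ≤ lam ^ w.length / r := by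
  obtain ⟨D, hD, hDb⟩ := S.exists_diam
  obtain ⟨K, hK, hKΩ, hgK⟩ := S.exists_core
  obtain ⟨δ, hδ, hδK⟩ := hK.exists_cthickening_subset_open S.hopen hKΩ
  set e := δ / D with he
  have he0 : 0 < e := by positivity
  refine ⟨(1 + e)⁻¹, by positivity, inv_lt_one_of_one_lt₀ (by linarith), ?_⟩
  intro w
  induction w with
  | nil =>
    intro h hh hb z r hr hz
    simp only [word_nil, Function.comp_id, List.length_nil, pow_zero]
    exact Complex.norm_deriv_le_of_forall_mem_sphere_norm_le hr
      (hh.mono (closure_ball_subset_closedBall.trans hz)).diffContOnCl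
      (fun x hx => hb x (hz (sphere_subset_closedBall hx)))
  | cons i v ih =>
    intro h hh hb z r hr hz
    have hzΩ : z ∈ S.Ω := hz (mem_closedBall_self hr.le)
    set p := S.word v z with hp
    have hpΩ : p ∈ S.Ω := S.word_maps v hzΩ
    set G : ℂ → ℂ := fun x => S.g i x + e * (S.g i x - S.g i p) with hG
    have hGmaps : ∀ x ∈ S.Ω, G x ∈ S.Ω := by
      intro x hx
      apply hδK
      apply mem_cthickening_of_dist_le _ (S.g i x) _ _ (hgK i (subset_closure ⟨x, hx, rfl⟩))
      rw [dist_eq_norm, hG]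
      simp only [add_sub_cancel_left, norm_mul, Complex.norm_real, Real.norm_eq_abs, abs_of_pos he0]
      calc e * ‖S.g i x - S.g i p‖ ≤ e * D := by
            gcongr; exact hDb _ (S.g_maps i hx) _ (S.g_maps i hpΩ)
        _ = δ := by rw [he]; field_simp
    have hGd : DifferentiableOn ℂ G S.Ω :=
      (S.hdiff i).add (((S.hdiff i).sub_const _).const_mul _)
    have key := ih (h ∘ G) (hh.comp hGd hGmaps) (fun x hx => hb _ (hGmaps x hx)) z r hr hz
    have hgd : HasDerivAt (S.g i) (deriv (S.g i) p) p :=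
      ((S.hdiff i).differentiableAt (S.hopen.mem_nhds hpΩ)).hasDerivAt
    have hwd : HasDerivAt (S.word v) (deriv (S.word v) z) z :=
      ((S.word_diff v).differentiableAt (S.hopen.mem_nhds hzΩ)).hasDerivAt
    have hhd : HasDerivAt h (deriv h (S.g i p)) (S.g i p) :=
      (hh.differentiableAt (S.hopen.mem_nhds (S.g_maps i hpΩ))).hasDerivAt
    have hGp : G p = S.g i p := by simp [hG]
    have hGd' : HasDerivAt G (deriv (S.g i) p + e * deriv (S.g i) p) p :=
      hgd.add ((hgd.sub_const _).const_mul _)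
    have d1 : HasDerivAt (h ∘ S.g i ∘ S.word v) (deriv h (S.g i p) * (deriv (S.g i) p * deriv (S.word v) z)) z :=
      HasDerivAt.comp z hhd (HasDerivAt.comp z hgd hwd)
    have d2 : HasDerivAt ((h ∘ G) ∘ S.word v) (deriv h (S.g i p) * (deriv (S.g i) p + e * deriv (S.g i) p) * deriv (S.word v) z) z := by
      refine HasDerivAt.comp z (HasDerivAt.comp p ?_ hGd') hwd
      rw [hGp]; exact hhd
    rw [d2.deriv] at key
    rw [word_cons, d1.deriv, List.length_cons, pow_succ]
    have e1 : deriv h (S.g i p) * (deriv (S.g i) p + e * deriv (S.g i) p) * deriv (S.word v) z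
      = ((1 + e : ℝ) : ℂ) * (deriv h (S.g i p) * (deriv (S.g i) p * deriv (S.word v) z)) := by
      push_cast; ring
    rw [e1, norm_mul, Complex.norm_real, Real.norm_eq_abs, abs_of_pos (by linarith)] at key
    have h1 : 0 < 1 + e := by linarith
    calc _ = (1 + e)⁻¹ * ((1 + e) * ‖deriv h (S.g i p) * (deriv (S.g i) p * deriv (S.word v) z)‖) := by
          field_simp
      _ ≤ (1 + e)⁻¹ * ((1 + e)⁻¹ ^ v.length / r) := by gcongr
      _ = _ := by ring

/-- local contraction -/
lemma contr_ball : ∃ lam : ℝ, 0 < lam ∧ lam < 1 ∧ ∃ C : ℝ, 0 < C ∧ ∀ (w : List (Fin S.m)) (z : ℂ) (r : ℝ),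
    0 < r → closedBall z (2 * r) ⊆ S.Ω → ∀ x ∈ closedBall z r, ∀ y ∈ closedBall z r,
      ‖S.word w x - S.word w y‖ ≤ C / r * lam ^ w.length * ‖x - y‖ := by
  obtain ⟨lam, h0, h1, hb⟩ := S.deriv_bound
  obtain ⟨D, hD, hDb⟩ := S.exists_diam
  obtain ⟨p, hp⟩ := S.hconn.nonempty
  refine ⟨lam, h0, h1, D, hD, ?_⟩
  intro w z r hr hz x hx y hy
  have hsub : closedBall z r ⊆ S.Ω := (closedBall_subset_closedBall (by linarith)).trans hz
  refine (convex_closedBall z r).norm_image_sub_le_of_norm_deriv_le (𝕜 := ℂ) ?_ ?_ hy hx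
  · intro a ha
    exact (S.word_diff w).differentiableAt (S.hopen.mem_nhds (hsub ha))
  · intro a ha
    have haΩ := hsub ha
    have := hb w (fun x => (x - p) / D) ((differentiableOn_id.sub_const p).div_const _) (by
      intro u hu
      rw [norm_div, Complex.norm_real, Real.norm_eq_abs, abs_of_pos hD]
      exact div_le_one_of_le₀ (hDb u hu p hp) hD.le) a r hr (by
        refine (closedBall_subset_closedBall' ?_).trans hz
        rw [mem_closedBall] at ha; linarith)
    have hwd : HasDerivAt (S.word w) (deriv (S.word w) a) a :=
      ((S.word_diff w).differentiableAt (S.hopen.mem_nhds haΩ)).hasDerivAt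
    have d : HasDerivAt ((fun x => (x - p) / D) ∘ S.word w) (deriv (S.word w) a / D) a :=
      (hwd.sub_const p).div_const _
    rw [d.deriv, norm_div, Complex.norm_real, Real.norm_eq_abs, abs_of_pos hD, div_le_iff₀ hD] at this
    calc _ ≤ _ := this
      _ = _ := by ring

end HolIFS

open Filter Topology
namespace HolIFS
variable (S : HolIFS)

lemma contr_cpt : ∃ lam : ℝ, 0 < lam ∧ lam < 1 ∧ ∀ K, IsCompact K → K ⊆ S.Ω → ∃ C : ℝ, 0 < C ∧
    ∀ x ∈ K, ∀ y ∈ K, ∀ w : List (Fin S.m), ‖S.word w x - S.word w y‖ ≤ C * lam ^ w.length := by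
  obtain ⟨lam, h0, h1, C, hC, hb⟩ := S.contr_ball
  refine ⟨lam, h0, h1, ?_⟩
  -- local uniform statement
  have hloc : ∀ x ∈ S.Ω, ∃ r > 0, ∀ y ∈ closedBall x r, ∀ w : List (Fin S.m),
      ‖S.word w x - S.word w y‖ ≤ C * lam ^ w.length := by
    intro x hx
    obtain ⟨r, hr, hrs⟩ := Metric.isOpen_iff.1 S.hopen x hx
    refine ⟨r / 4, by positivity, fun y hy w => ?_⟩
    have := hb w x (r/4) (by positivity) ((closedBall_subset_ball (by linarith)).trans hrs) x
      (mem_closedBall_self (by positivity)) y hy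
    have hy' : ‖x - y‖ ≤ r / 4 := by rw [← dist_eq_norm, dist_comm]; exact hy
    calc _ ≤ _ := this
      _ ≤ C / (r/4) * lam ^ w.length * (r/4) := by gcongr
      _ = _ := by field_simp
  have hconn : ∀ x ∈ S.Ω, ∀ y ∈ S.Ω, ∃ C : ℝ, ∀ w : List (Fin S.m),
      ‖S.word w x - S.word w y‖ ≤ C * lam ^ w.length := by
    intro x hx y hy
    refine S.hconn.isPreconnected.induction₂ (fun x y => ∃ C : ℝ, ∀ w : List (Fin S.m),
      ‖S.word w x - S.word w y‖ ≤ C * lam ^ w.length) ?_ ?_ ?_ hx hy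
    · intro x hx
      obtain ⟨r, hr, h⟩ := hloc x hx
      filter_upwards [nhdsWithin_le_nhds (closedBall_mem_nhds x hr)] with y hy
      exact ⟨C, h y hy⟩
    · rintro x y z - - - ⟨C1, h1⟩ ⟨C2, h2⟩
      refine ⟨C1 + C2, fun w => ?_⟩
      calc _ ≤ ‖S.word w x - S.word w y‖ + ‖S.word w y - S.word w z‖ := norm_sub_le_norm_sub_add_norm_sub _ _ _
        _ ≤ _ := by rw [add_mul]; exact add_le_add (h1 w) (h2 w)
    · rintro x y - - ⟨C1, h1⟩
      exact ⟨C1, fun w => by rw [norm_sub_rev]; exact h1 w⟩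
  intro K hK hKΩ
  obtain ⟨p, hp⟩ := S.hconn.nonempty
  have key : ∃ C : ℝ, ∀ x ∈ K, ∀ w : List (Fin S.m), ‖S.word w x - S.word w p‖ ≤ C * lam ^ w.length := by
    refine hK.induction_on (p := fun s => ∃ C : ℝ, ∀ x ∈ s, ∀ w : List (Fin S.m), ‖S.word w x - S.word w p‖ ≤ C * lam ^ w.length) ?_ ?_ ?_ ?_
    · exact ⟨0, by simp⟩
    · rintro s t hst ⟨C, h⟩
      exact ⟨C, fun x hx => h x (hst hx)⟩
    · rintro s t ⟨C1, h1⟩ ⟨C2, h2⟩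
      refine ⟨max C1 C2, fun x hx w => ?_⟩
      rcases hx with hx | hx
      · exact (h1 x hx w).trans (by gcongr; exact le_max_left _ _)
      · exact (h2 x hx w).trans (by gcongr; exact le_max_right _ _)
    · intro x hx
      obtain ⟨r, hr, h⟩ := hloc x (hKΩ hx)
      obtain ⟨C2, h2⟩ := hconn x (hKΩ hx) p hp
      refine ⟨closedBall x r, nhdsWithin_le_nhds (closedBall_mem_nhds x hr), C + C2, fun y hy w => ?_⟩
      calc _ ≤ ‖S.word w y - S.word w x‖ + ‖S.word w x - S.word w p‖ := norm_sub_le_norm_sub_add_norm_sub _ _ _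
        _ ≤ _ := by rw [add_mul, norm_sub_rev (S.word w y)]; exact add_le_add (h y hy w) (h2 w)
  obtain ⟨C, hC⟩ := key
  refine ⟨2 * max C 1, by positivity, fun x hx y hy w => ?_⟩
  calc _ ≤ ‖S.word w x - S.word w p‖ + ‖S.word w p - S.word w y‖ := norm_sub_le_norm_sub_add_norm_sub _ _ _
    _ ≤ C * lam ^ w.length + C * lam ^ w.length := by
        rw [norm_sub_rev (S.word w p)]; exact add_le_add (hC x hx w) (hC y hy w)
    _ = 2 * C * lam ^ w.length := by ring
    _ ≤ _ := by gcongr; exact le_max_left _ _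

variable {S} {A : Set ℂ}

lemma IsAttractor.g_mem (h : S.IsAttractor A) (i : Fin S.m) {z : ℂ} (hz : z ∈ A) : S.g i z ∈ A := by
  rw [h.2.2.2]; exact mem_iUnion.2 ⟨i, z, hz, rfl⟩

lemma IsAttractor.word_mem (h : S.IsAttractor A) (w : List (Fin S.m)) {z : ℂ} (hz : z ∈ A) :
    S.word w z ∈ A := by
  induction w with
  | nil => exact hz
  | cons i v ih => exact h.g_mem i ih

lemma IsAttractor.exists_g (h : S.IsAttractor A) {z : ℂ} (hz : z ∈ A) : ∃ i, ∃ y ∈ A, S.g i y = z := by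
  rw [h.2.2.2] at hz
  obtain ⟨i, y, hy, e⟩ := mem_iUnion.1 hz
  exact ⟨i, y, hy, e⟩

lemma IsAttractor.exists_word (h : S.IsAttractor A) (n : ℕ) {z : ℂ} (hz : z ∈ A) :
    ∃ w : List (Fin S.m), w.length = n ∧ ∃ y ∈ A, S.word w y = z := by
  induction n generalizing z with
  | zero => exact ⟨[], rfl, z, hz, rfl⟩
  | succ n ih =>
    obtain ⟨i, y, hy, e⟩ := h.exists_g hz
    obtain ⟨w, hw, x, hx, e2⟩ := ih hy
    exact ⟨i :: w, by simp [hw], x, hx, by simp [e2, e]⟩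

/-- points in arbitrarily deep images belong to the attractor -/
lemma IsAttractor.mem_of_deep (h : S.IsAttractor A) {z : ℂ}
    (hz : ∀ n, ∃ w : List (Fin S.m), n ≤ w.length ∧ ∃ y ∈ S.Ω, S.word w y = z) : z ∈ A := by
  obtain ⟨lam, h0, h1, hc⟩ := S.contr_cpt
  obtain ⟨K, hK, hKΩ, hgK⟩ := S.exists_core
  obtain ⟨C, hC, hb⟩ := hc (K ∪ A) (hK.union h.2.1) (union_subset hKΩ h.2.2.1)
  obtain ⟨a, ha⟩ := h.1
  rw [← h.2.1.isClosed.closure_eq, Metric.mem_closure_iff]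
  intro ε hε
  obtain ⟨n, hn⟩ := exists_pow_lt_of_lt_one (div_pos hε hC) h1
  obtain ⟨w, hw, y, hy, e⟩ := hz (n+1)
  have hwne : w ≠ [] := by rintro rfl; simp at hw
  obtain ⟨v, i, rfl⟩ : ∃ v i, w = v ++ [i] := ⟨w.dropLast, w.getLast hwne, (List.dropLast_append_getLast hwne).symm⟩
  rw [word_append] at e
  simp only [word_cons, word_nil, Function.comp_id] at e
  refine ⟨S.word v a, h.word_mem v ha, ?_⟩
  rw [← e, dist_eq_norm]
  have hv : n ≤ v.length := by simp at hw; omega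
  calc _ ≤ C * lam ^ v.length := hb _ (Or.inl (hgK i (subset_closure ⟨y, hy, rfl⟩))) _ (Or.inr ha) v
    _ ≤ C * lam ^ n := by gcongr 1; exact pow_le_pow_of_le_one h0.le h1.le hv
    _ < C * (ε / C) := by gcongr
    _ = ε := by field_simp

lemma IsAttractor.contr (h : S.IsAttractor A) : ∃ lam : ℝ, 0 < lam ∧ lam < 1 ∧ ∃ C : ℝ, 0 < C ∧
    ∀ x ∈ A, ∀ y ∈ A, ∀ w : List (Fin S.m), ‖S.word w x - S.word w y‖ ≤ C * lam ^ w.length * ‖x - y‖ := by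
  obtain ⟨lam, h0, h1, C, hC, hb⟩ := S.contr_ball
  obtain ⟨lam', h0', h1', hc⟩ := S.contr_cpt
  obtain ⟨C', hC', hb'⟩ := hc A h.2.1 h.2.2.1
  obtain ⟨δ, hδ, hδA⟩ := h.2.1.exists_cthickening_subset_open S.hopen h.2.2.1
  refine ⟨max lam lam', by positivity, max_lt h1 h1', max (C / (δ/2)) (C' / (δ/2)), by positivity, ?_⟩
  intro x hx y hy w
  by_cases hxy : ‖x - y‖ ≤ δ / 2
  · have := hb w x (δ/2) (by positivity) (by
      rw [show 2 * (δ/2) = δ by ring]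
      exact (closedBall_subset_cthickening hx δ).trans hδA) x (mem_closedBall_self (by positivity)) y
      (by rw [mem_closedBall, dist_comm, dist_eq_norm]; exact hxy)
    refine this.trans ?_
    gcongr
    · exact le_max_left _ _
    · exact le_max_left _ _
  · push Not at hxy
    calc _ ≤ C' * lam' ^ w.length := hb' x hx y hy w
      _ = C' / (δ/2) * lam' ^ w.length * (δ/2) := by field_simp
      _ ≤ _ := by
        gcongr
        · exact le_max_right _ _
        · exact le_max_right _ _

lemma g_cont (S : HolIFS) (i : Fin S.m) : ContinuousOn (S.g i) S.Ω := (S.hdiff i).continuousOn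

lemma IsAttractor.gap (h : S.IsAttractor A) (hS : S.SSC A) : ∃ γ > 0, ∀ i j : Fin S.m, i ≠ j →
    ∀ a ∈ A, ∀ b ∈ A, γ ≤ ‖S.g i a - S.g j b‖ := by
  have : ∀ p : Fin S.m × Fin S.m, ∃ γ > 0, p.1 ≠ p.2 →
    ∀ a ∈ A, ∀ b ∈ A, γ ≤ ‖S.g p.1 a - S.g p.2 b‖ := by
    rintro ⟨i, j⟩
    by_cases hij : i = j
    · exact ⟨1, one_pos, fun h => absurd hij h⟩
    have hc : ∀ i, IsCompact (S.g i '' A) := fun i =>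
      h.2.1.image_of_continuousOn ((S.g_cont i).mono h.2.2.1)
    obtain ⟨r, hr, hrr⟩ := (hS i j hij).exists_thickenings (hc i) (hc j).isClosed
    refine ⟨r, hr, fun _ a ha b hb => ?_⟩
    by_contra hlt
    push Not at hlt
    have m1 : S.g j b ∈ thickening r (S.g i '' A) :=
      mem_thickening_iff.2 ⟨S.g i a, ⟨a, ha, rfl⟩, by rw [dist_comm, dist_eq_norm]; exact hlt⟩
    have m2 : S.g j b ∈ thickening r (S.g j '' A) := self_subset_thickening hr _ ⟨b, hb, rfl⟩
    exact disjoint_left.1 hrr m1 m2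
  choose γ hγ hγ2 using this
  have hne : (Finset.univ : Finset (Fin S.m × Fin S.m)).Nonempty := ⟨(⟨0, S.hm⟩, ⟨0, S.hm⟩), Finset.mem_univ _⟩
  refine ⟨Finset.univ.inf' hne γ, (Finset.lt_inf'_iff hne).2 fun p _ => hγ p, ?_⟩
  intro i j hij a ha b hb
  exact (Finset.inf'_le γ (Finset.mem_univ (i, j))).trans (hγ2 (i,j) hij a ha b hb)

lemma word_cont (S : HolIFS) (w : List (Fin S.m)) : ContinuousOn (S.word w) S.Ω := (S.word_diff w).continuousOn

lemma IsAttractor.exists_box (h : S.IsAttractor A) (hS : S.SSC A) : ∃ V, S.IsBoxLike A V := by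
  obtain ⟨lam, h0, h1, hc⟩ := S.contr_cpt
  obtain ⟨lb, hlb0, hlb1, C, hC, hb⟩ := S.contr_ball
  obtain ⟨γ, hγ, hgap⟩ := h.gap hS
  obtain ⟨r, hr, hrA⟩ := h.2.1.exists_cthickening_subset_open S.hopen h.2.2.1
  obtain ⟨mu, hmu1, hmu2⟩ := exists_between h1
  have hmu0 : 0 < mu := h0.trans hmu1
  obtain ⟨δ, hδ0, hδr, hδγ⟩ : ∃ δ > 0, δ ≤ r / 2 ∧ C / (r/2) * lb * δ ≤ γ / 4 := by
    refine ⟨min (r/2) (γ / 4 / (C / (r/2) * lb)), by positivity, min_le_left _ _, ?_⟩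
    calc _ ≤ C / (r/2) * lb * (γ / 4 / (C / (r/2) * lb)) := by gcongr; exact min_le_right _ _
      _ = _ := by field_simp
  set V : Set ℂ := {z | z ∈ S.Ω ∧ ∀ w : List (Fin S.m), infDist (S.word w z) A < δ * mu ^ w.length} with hV
  refine ⟨V, ?_, fun z hz => hz.1, ?_, ?_, ?_⟩
  · rw [isOpen_iff_mem_nhds]
    rintro z ⟨hzΩ, hz⟩
    obtain ⟨s, hs, hsb⟩ := Metric.isOpen_iff.1 S.hopen z hzΩ
    obtain ⟨C2, hC2, hb2⟩ := hc (closedBall z (s/2) ∪ A) ((isCompact_closedBall z (s/2)).union h.2.1)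
      (union_subset ((closedBall_subset_ball (by linarith)).trans hsb) h.2.2.1)
    obtain ⟨a, ha⟩ := h.1
    obtain ⟨N, hN⟩ := exists_pow_lt_of_lt_one (div_pos hδ0 hC2) (show lam / mu < 1 by rw [div_lt_one hmu0]; exact hmu1)
    have hfin : {w : List (Fin S.m) | w.length < N}.Finite := List.finite_length_lt _ N
    have hev : ∀ᶠ x in 𝓝 z, ∀ w ∈ {w : List (Fin S.m) | w.length < N},
        infDist (S.word w x) A < δ * mu ^ w.length := by
      rw [Filter.eventually_all_finite hfin]
      intro w _
      have hcont : ContinuousAt (fun x => infDist (S.word w x) A) z :=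
        (continuous_infDist_pt A).continuousAt.comp ((S.word_cont w).continuousAt (S.hopen.mem_nhds hzΩ))
      exact hcont.eventually_lt continuousAt_const (hz w)
    filter_upwards [hev, closedBall_mem_nhds z (half_pos hs), S.hopen.mem_nhds hzΩ] with x hx hxb hxΩ
    refine ⟨hxΩ, fun w => ?_⟩
    by_cases hw : w.length < N
    · exact hx w hw
    · push Not at hw
      calc infDist (S.word w x) A ≤ dist (S.word w x) (S.word w a) := infDist_le_dist_of_mem (h.word_mem w ha)
        _ ≤ C2 * lam ^ w.length := by rw [dist_eq_norm]; exact hb2 x (Or.inl hxb) a (Or.inr ha) w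
        _ = C2 * (lam/mu) ^ w.length * mu ^ w.length := by rw [div_pow]; field_simp
        _ ≤ C2 * (lam/mu) ^ N * mu ^ w.length := by
            gcongr C2 * ?_ * _
            exact pow_le_pow_of_le_one (by positivity) (by rw [div_le_one hmu0]; exact hmu1.le) hw
        _ < C2 * (δ / C2) * mu ^ w.length := by gcongr
        _ = _ := by field_simp
  · intro z hz
    refine ⟨h.2.2.1 hz, fun w => ?_⟩
    rw [infDist_zero_of_mem (h.word_mem w hz)]
    positivity
  · intro i x hx
    have hxΩ : x ∈ S.Ω := S.hcl i (closure_mono (image_mono (fun z hz => hz.1)) hx)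
    refine ⟨hxΩ, fun w => ?_⟩
    have hcont : ContinuousAt (fun x => infDist (S.word w x) A) x :=
        (continuous_infDist_pt A).continuousAt.comp ((S.word_cont w).continuousAt (S.hopen.mem_nhds hxΩ))
    have hle : infDist (S.word w x) A ≤ δ * mu ^ (w.length + 1) := by
      by_contra hlt
      push Not at hlt
      have hev := hcont.eventually_const_lt hlt
      obtain ⟨y, hy1, z, hz, rfl⟩ := mem_closure_iff_nhds.1 hx _ hev
      have h2 := hz.2 (w ++ [i])
      rw [word_append] at h2
      simp at h2
      have h3 : δ * mu ^ (w.length + 1) < infDist (S.word w (S.g i z)) A := hy1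
      linarith
    refine hle.trans_lt ?_
    rw [pow_succ]
    have : 0 < mu ^ w.length := by positivity
    have hmu3 : mu < 1 := hmu2
    calc δ * (mu ^ w.length * mu) < δ * (mu ^ w.length * 1) := by gcongr
      _ = _ := by ring
  · have hVnear : ∀ i, ∀ x ∈ closure (S.g i '' V), ∃ a ∈ A, dist x (S.g i a) < γ / 2 := by
      intro i x hx
      obtain ⟨y, ⟨z, hz, rfl⟩, hy⟩ := Metric.mem_closure_iff.1 hx (γ/4) (by positivity)
      have h2 := hz.2 []
      simp at h2
      obtain ⟨a, ha, hd⟩ := (infDist_lt_iff h.1).1 h2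
      refine ⟨a, ha, ?_⟩
      have := hb [i] a (r/2) (by positivity) (by
        rw [show 2 * (r/2) = r by ring]
        exact (closedBall_subset_cthickening ha r).trans hrA) z
        (by rw [mem_closedBall]; linarith) a (mem_closedBall_self (by positivity))
      simp at this
      have h3 : dist (S.g i z) (S.g i a) ≤ γ / 4 := by
        rw [dist_eq_norm]
        refine le_trans ?_ hδγ
        refine this.trans ?_
        rw [← dist_eq_norm]
        gcongr
      calc _ ≤ dist x (S.g i z) + dist (S.g i z) (S.g i a) := dist_triangle _ _ _
        _ < γ / 4 + γ / 4 := by linarith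
        _ = _ := by ring
    intro i j hij
    rw [disjoint_left]
    intro x hxi hxj
    obtain ⟨a, ha, hda⟩ := hVnear i x hxi
    obtain ⟨b, hb', hdb⟩ := hVnear j x hxj
    have := hgap i j hij a ha b hb'
    rw [← dist_eq_norm] at this
    have := dist_triangle_left (S.g i a) (S.g j b) x
    linarith

end HolIFS

open Filter Topology
namespace HolIFS
variable {S : HolIFS} {A : Set ℂ}

lemma dslope_symm (f : ℂ → ℂ) (a b : ℂ) : dslope f a b = dslope f b a := by
  by_cases h : a = b
  · rw [h]
  · rw [dslope_of_ne f (Ne.symm h), dslope_of_ne f h, slope_comm]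

lemma IsAttractor.q_lip (h : S.IsAttractor A) (i : Fin S.m) : ∃ L > 0, ∀ y ∈ A, ∀ x ∈ A, ∀ x' ∈ A,
    ‖dslope (S.g i) y x - dslope (S.g i) y x'‖ ≤ L * ‖x - x'‖ := by
  obtain ⟨lam, h0, h1, C, hC, hb⟩ := S.contr_ball
  obtain ⟨δ, hδ, hδA⟩ := h.2.1.exists_cthickening_subset_open S.hopen h.2.2.1
  obtain ⟨D, hD, hDb⟩ := S.exists_diam
  have hball : ∀ y ∈ A, closedBall y δ ⊆ S.Ω := fun y hy => (closedBall_subset_cthickening hy δ).trans hδA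
  set B := max (C / (δ/2) * lam) (D / (δ/2)) with hB
  have hB0 : 0 < B := by positivity
  have hbd : ∀ y ∈ A, ∀ x ∈ S.Ω, ‖dslope (S.g i) y x‖ ≤ B := by
    intro y hy x hx
    have hlip : ∀ x ∈ closedBall y (δ/2), ‖S.g i x - S.g i y‖ ≤ C / (δ/2) * lam * ‖x - y‖ := by
      intro x hx
      have := hb [i] y (δ/2) (by positivity) (by
        rw [show 2 * (δ/2) = δ by ring]; exact hball y hy) x hx y (mem_closedBall_self (by positivity))
      simpa using this
    by_cases hxy : x = y
    · subst hxy
      rw [dslope_same]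
      refine (norm_deriv_le_of_lip' (C := C / (δ/2) * lam) (by positivity) ?_).trans (le_max_left _ _)
      filter_upwards [closedBall_mem_nhds x (half_pos hδ)] with z hz using hlip z hz
    · rw [dslope_of_ne _ hxy, slope_def_field, norm_div]
      have hpos : 0 < ‖x - y‖ := norm_pos_iff.2 (sub_ne_zero.2 hxy)
      rw [div_le_iff₀ hpos]
      by_cases hc : x ∈ closedBall y (δ/2)
      · refine (hlip x hc).trans ?_
        gcongr; exact le_max_left _ _
      · rw [mem_closedBall, dist_eq_norm] at hc
        push Not at hc
        calc _ ≤ D := hDb _ (S.g_maps i hx) _ (S.g_maps i (h.2.2.1 hy))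
          _ = D / (δ/2) * (δ/2) := by field_simp
          _ ≤ B * ‖x - y‖ := by gcongr; exact le_max_right _ _
  refine ⟨2 * B / (δ/4), by positivity, ?_⟩
  intro y hy x hx x' hx'
  by_cases hc : ‖x - x'‖ ≤ δ / 4
  · have hd : DifferentiableOn ℂ (dslope (S.g i) y) S.Ω :=
      (Complex.differentiableOn_dslope (S.hopen.mem_nhds (h.2.2.1 hy))).2 (S.hdiff i)
    have hsub : closedBall x (δ/4) ⊆ S.Ω := (closedBall_subset_closedBall (by linarith)).trans (hball x hx)
    have := (convex_closedBall x (δ/4)).norm_image_sub_le_of_norm_deriv_le (𝕜 := ℂ)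
      (f := dslope (S.g i) y) (C := B / (δ/4)) (x := x') (y := x) ?_ ?_ ?_ ?_
    · refine this.trans ?_
      gcongr
      linarith
    · intro z hz
      exact hd.differentiableAt (S.hopen.mem_nhds (hsub hz))
    · intro z hz
      have hsub2 : closedBall z (δ/4) ⊆ S.Ω := by
        refine (closedBall_subset_closedBall' ?_).trans (hball x hx)
        rw [mem_closedBall] at hz; linarith
      exact Complex.norm_deriv_le_of_forall_mem_sphere_norm_le (by positivity)
        (hd.mono (closure_ball_subset_closedBall.trans hsub2)).diffContOnCl
        (fun u hu => hbd y hy u (hsub2 (sphere_subset_closedBall hu)))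
    · rw [mem_closedBall, dist_comm, dist_eq_norm]; exact hc
    · exact mem_closedBall_self (by positivity)
  · push Not at hc
    calc _ ≤ ‖dslope (S.g i) y x‖ + ‖dslope (S.g i) y x'‖ := norm_sub_le _ _
      _ ≤ B + B := add_le_add (hbd y hy x (h.2.2.1 hx)) (hbd y hy x' (h.2.2.1 hx'))
      _ = 2 * B / (δ/4) * (δ/4) := by field_simp; ring
      _ ≤ _ := by gcongr

lemma IsAttractor.q_lip2 (h : S.IsAttractor A) (i : Fin S.m) : ∃ L > 0, ∃ c > 0,
    (∀ y ∈ A, ∀ x ∈ A, ∀ y' ∈ A, ∀ x' ∈ A,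
    ‖dslope (S.g i) y x - dslope (S.g i) y' x'‖ ≤ L * (‖x - x'‖ + ‖y - y'‖)) ∧
    ∀ y ∈ A, ∀ x ∈ A, c ≤ ‖dslope (S.g i) y x‖ := by
  obtain ⟨L, hL, hq⟩ := h.q_lip i
  have key : ∀ y ∈ A, ∀ x ∈ A, ∀ y' ∈ A, ∀ x' ∈ A,
    ‖dslope (S.g i) y x - dslope (S.g i) y' x'‖ ≤ L * (‖x - x'‖ + ‖y - y'‖) := by
    intro y hy x hx y' hy' x' hx'
    calc _ ≤ ‖dslope (S.g i) y x - dslope (S.g i) y x'‖ + ‖dslope (S.g i) y x' - dslope (S.g i) y' x'‖ :=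
          norm_sub_le_norm_sub_add_norm_sub _ _ _
      _ ≤ L * ‖x - x'‖ + L * ‖y - y'‖ := by
          refine add_le_add (hq y hy x hx x' hx') ?_
          rw [dslope_symm _ y x', dslope_symm _ y' x']
          exact hq x' hx' y hy y' hy'
      _ = _ := by ring
  have hcont : ContinuousOn (fun p : ℂ × ℂ => ‖dslope (S.g i) p.1 p.2‖) (A ×ˢ A) := by
    apply ContinuousOn.norm
    have : LipschitzOnWith (Real.toNNReal (2 * L)) (fun p : ℂ × ℂ => dslope (S.g i) p.1 p.2) (A ×ˢ A) := by
      apply LipschitzOnWith.of_dist_le_mul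
      rintro ⟨y, x⟩ ⟨hy, hx⟩ ⟨y', x'⟩ ⟨hy', hx'⟩
      rw [dist_eq_norm, Real.coe_toNNReal _ (by positivity)]
      refine (key y hy x hx y' hy' x' hx').trans ?_
      rw [Prod.dist_eq, dist_eq_norm, dist_eq_norm]
      have h1 := le_max_left ‖y - y'‖ ‖x - x'‖
      have h2 := le_max_right ‖y - y'‖ ‖x - x'‖
      calc L * (‖x - x'‖ + ‖y - y'‖) ≤ L * (max ‖y - y'‖ ‖x - x'‖ + max ‖y - y'‖ ‖x - x'‖) := by gcongr
        _ = _ := by ring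
    exact this.continuousOn
  obtain ⟨p, hp, hmin⟩ := (h.2.1.prod h.2.1).exists_isMinOn (h.1.prod h.1) hcont
  refine ⟨L, hL, ‖dslope (S.g i) p.1 p.2‖, ?_, key, fun y hy x hx => isMinOn_iff.1 hmin (y, x) (mk_mem_prod hy hx)⟩
  rw [gt_iff_lt, norm_pos_iff]
  by_cases hpp : p.2 = p.1
  · rw [hpp, dslope_same]
    exact deriv_ne_zero_of_injOn S.hopen (S.hdiff i) (S.hinj i) (h.2.2.1 hp.1)
  · rw [dslope_of_ne _ hpp, slope_def_field]
    refine div_ne_zero (sub_ne_zero.2 fun e => hpp (S.hinj i (h.2.2.1 hp.2) (h.2.2.1 hp.1) e)) (sub_ne_zero.2 hpp)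

lemma IsAttractor.q_all (h : S.IsAttractor A) : ∃ L > 0, ∃ c > 0, ∀ i,
    (∀ y ∈ A, ∀ x ∈ A, ∀ y' ∈ A, ∀ x' ∈ A,
    ‖dslope (S.g i) y x - dslope (S.g i) y' x'‖ ≤ L * (‖x - x'‖ + ‖y - y'‖)) ∧
    ∀ y ∈ A, ∀ x ∈ A, c ≤ ‖dslope (S.g i) y x‖ := by
  choose L hL c hc h1 h2 using fun i => h.q_lip2 i
  have hne : (Finset.univ : Finset (Fin S.m)).Nonempty := ⟨⟨0, S.hm⟩, Finset.mem_univ _⟩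
  refine ⟨Finset.univ.sup' hne L, (Finset.lt_sup'_iff hne).2 ⟨_, Finset.mem_univ ⟨0, S.hm⟩, hL _⟩,
    Finset.univ.inf' hne c, (Finset.lt_inf'_iff hne).2 fun i _ => hc i, fun i => ⟨?_, ?_⟩⟩
  · intro y hy x hx y' hy' x' hx'
    refine (h1 i y hy x hx y' hy' x' hx').trans ?_
    gcongr
    exact Finset.le_sup' L (Finset.mem_univ i)
  · intro y hy x hx
    exact (Finset.inf'_le c (Finset.mem_univ i)).trans (h2 i y hy x hx)

/-- divided differences of words -/
noncomputable def Q (S : HolIFS) : List (Fin S.m) → ℂ → ℂ → ℂ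
  | [], _, _ => 1
  | i :: w, x, y => dslope (S.g i) (S.word w y) (S.word w x) * Q S w x y

lemma Q_spec (w : List (Fin S.m)) (x y : ℂ) : S.word w x - S.word w y = S.Q w x y * (x - y) := by
  induction w with
  | nil => simp [Q]
  | cons i w ih =>
    simp only [word_cons, Function.comp, Q]
    rw [mul_assoc, ← ih, mul_comm, ← smul_eq_mul, sub_smul_dslope]

/-- The metric data of the system on its attractor. -/
structure Core (S : HolIFS) (A : Set ℂ) (ρ : List (Fin S.m) → ℝ) (C : ℝ) : Prop where
  C1 : 1 ≤ C
  pos : ∀ w, 0 < ρ w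
  nil : ρ [] ≤ 1 ∧ 1 ≤ C * ρ []
  lower : ∀ w, ∀ x ∈ A, ∀ y ∈ A, ρ w ≤ ‖S.Q w x y‖
  upper : ∀ w, ∀ x ∈ A, ∀ y ∈ A, ‖S.Q w x y‖ ≤ C * ρ w
  lip : ∀ w, ∀ x ∈ A, ∀ y ∈ A, ∀ x' ∈ A, ∀ y' ∈ A,
    ‖S.Q w x y - S.Q w x' y'‖ ≤ C * ρ w * (‖x - x'‖ + ‖y - y'‖)
  diam : ∀ x ∈ A, ∀ y ∈ A, ‖x - y‖ ≤ C

set_option maxHeartbeats 2000000 in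
lemma IsAttractor.core (h : S.IsAttractor A) : ∃ ρ C, S.Core A ρ C := by
  obtain ⟨L, hL, c, hc, hq⟩ := h.q_all
  obtain ⟨lam, h0, h1, C, hC, hb⟩ := h.contr
  obtain ⟨D, hD, hDb⟩ := S.exists_diam
  have hQne : ∀ w, ∀ x ∈ A, ∀ y ∈ A, S.Q w x y ≠ 0 := by
    intro w x hx y hy
    induction w with
    | nil => simp [Q]
    | cons i w ih =>
      refine mul_ne_zero ?_ ih
      have := (hq i).2 _ (h.word_mem w hy) _ (h.word_mem w hx)
      exact norm_pos_iff.1 (hc.trans_le this)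
  set H := L / c * C with hH
  have hH0 : 0 < H := by positivity
  have hratio : ∀ w, ∀ x ∈ A, ∀ y ∈ A, ∀ x' ∈ A, ∀ y' ∈ A,
      ‖S.Q w x y / S.Q w x' y' - 1‖ ≤
        Real.exp (H * (‖x - x'‖ + ‖y - y'‖) * ∑ j ∈ Finset.range w.length, lam ^ j) - 1 := by
    intro w x hx y hy x' hx' y' hy'
    induction w with
    | nil => simp [Q]
    | cons i w ih =>
      set d := ‖x - x'‖ + ‖y - y'‖ with hd
      have hd0 : 0 ≤ d := by positivity
      set R := S.Q w x y / S.Q w x' y' with hR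
      set q1 := dslope (S.g i) (S.word w y) (S.word w x) with hq1
      set q2 := dslope (S.g i) (S.word w y') (S.word w x') with hq2
      have hq2n : c ≤ ‖q2‖ := (hq i).2 _ (h.word_mem w hy') _ (h.word_mem w hx')
      have hq2ne : q2 ≠ 0 := norm_pos_iff.1 (hc.trans_le hq2n)
      set e := q1 / q2 - 1 with he
      have hen : ‖e‖ ≤ H * d * lam ^ w.length := by
        have : e = (q1 - q2) / q2 := by rw [he]; field_simp
        rw [this, norm_div]
        have h3 : ‖q1 - q2‖ ≤ L * (C * lam ^ w.length * ‖x - x'‖ + C * lam ^ w.length * ‖y - y'‖) := by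
          refine ((hq i).1 _ (h.word_mem w hy) _ (h.word_mem w hx) _ (h.word_mem w hy') _ (h.word_mem w hx')).trans ?_
          gcongr
          · exact hb x hx x' hx' w
          · exact hb y hy y' hy' w
        calc _ ≤ L * (C * lam ^ w.length * ‖x - x'‖ + C * lam ^ w.length * ‖y - y'‖) / c := by gcongr
          _ = _ := by rw [hH, hd]; field_simp
      have e1 : S.Q (i :: w) x y / S.Q (i :: w) x' y' = R * (1 + e) := by
        show q1 * S.Q w x y / (q2 * S.Q w x' y') = _
        have := hQne w x' hx' y' hy'
        rw [hR, he]; field_simp; ring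
      rw [e1, List.length_cons, Finset.sum_range_succ, mul_add (H * d), Real.exp_add]
      have e2 : R * (1 + e) - 1 = (R - 1) * (1 + e) + e := by ring
      set E := Real.exp (H * d * ∑ j ∈ Finset.range w.length, lam ^ j) with hE
      have hE1 : 1 ≤ E := Real.one_le_exp (by positivity)
      calc ‖R * (1 + e) - 1‖ ≤ ‖R - 1‖ * ‖1 + e‖ + ‖e‖ := by
            rw [e2, ← norm_mul]; exact norm_add_le _ _
        _ ≤ (E - 1) * (1 + ‖e‖) + ‖e‖ := by
            gcongr
            exact (norm_add_le _ _).trans (by simp)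
        _ = E * (1 + ‖e‖) - 1 := by ring
        _ ≤ E * (1 + H * d * lam ^ w.length) - 1 := by gcongr
        _ ≤ E * Real.exp (H * d * lam ^ w.length) - 1 := by
            gcongr
            rw [add_comm]; exact Real.add_one_le_exp _
  set T := H * (1 - lam)⁻¹ with hT
  have h1l : 0 < 1 - lam := by linarith
  have hT0 : 0 < T := by positivity
  set E := Real.exp (T * (2 * D)) with hE
  have hE1 : 1 ≤ E := Real.one_le_exp (by positivity)
  have hratio2 : ∀ w, ∀ x ∈ A, ∀ y ∈ A, ∀ x' ∈ A, ∀ y' ∈ A,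
      ‖S.Q w x y / S.Q w x' y' - 1‖ ≤ T * E * (‖x - x'‖ + ‖y - y'‖) ∧ ‖S.Q w x y / S.Q w x' y' - 1‖ ≤ E - 1 := by
    intro w x hx y hy x' hx' y' hy'
    set d := ‖x - x'‖ + ‖y - y'‖ with hd
    have hd0 : 0 ≤ d := by positivity
    have hdD : d ≤ 2 * D := by
      have a1 := hDb x (h.2.2.1 hx) x' (h.2.2.1 hx')
      have a2 := hDb y (h.2.2.1 hy) y' (h.2.2.1 hy')
      linarith
    have hs : ∑ j ∈ Finset.range w.length, lam ^ j ≤ (1 - lam)⁻¹ := by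
      rw [← tsum_geometric_of_lt_one h0.le h1]
      exact Summable.sum_le_tsum _ (fun i _ => by positivity) (summable_geometric_of_lt_one h0.le h1)
    have h2 : ‖S.Q w x y / S.Q w x' y' - 1‖ ≤ Real.exp (T * d) - 1 := by
      refine (hratio w x hx y hy x' hx' y' hy').trans ?_
      have h9 : H * d * ∑ j ∈ Finset.range w.length, lam ^ j ≤ T * d := by
        calc _ ≤ H * d * (1 - lam)⁻¹ := by gcongr
          _ = _ := by rw [hT]; ring
      exact sub_le_sub_right (Real.exp_le_exp.2 h9) 1
    have h3 : Real.exp (T * d) ≤ E := by rw [hE]; gcongr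
    refine ⟨h2.trans ?_, h2.trans (by linarith)⟩
    have h4 : 1 - T * d ≤ Real.exp (- (T * d)) := by
      have := Real.add_one_le_exp (-(T * d)); linarith
    have h5 : Real.exp (T * d) * Real.exp (-(T * d)) = 1 := by rw [← Real.exp_add]; simp
    have h6 : 0 < Real.exp (T * d) := Real.exp_pos _
    have h7 : Real.exp (T * d) - 1 ≤ Real.exp (T * d) * (T * d) := by nlinarith
    have h8 : 0 ≤ T * d := by positivity
    nlinarith
  obtain ⟨a, ha⟩ := h.1
  have hcmp : ∀ w, ∀ x ∈ A, ∀ y ∈ A, ∀ x' ∈ A, ∀ y' ∈ A, ‖S.Q w x y‖ ≤ E * ‖S.Q w x' y'‖ := by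
    intro w x hx y hy x' hx' y' hy'
    have h1 := (hratio2 w x hx y hy x' hx' y' hy').2
    have h2 : S.Q w x y = ((S.Q w x y / S.Q w x' y' - 1) + 1) * S.Q w x' y' := by
      have := hQne w x' hx' y' hy'
      field_simp; ring
    rw [h2, norm_mul]
    gcongr
    refine (norm_add_le _ _).trans ?_
    simp; linarith
  refine ⟨fun w => ‖S.Q w a a‖ / E, max (max (E * E) (E * E * (T * E))) D, ?_⟩
  have hE0 : 0 < E := by positivity
  have hEE : E * E ≤ max (max (E * E) (E * E * (T * E))) D := (le_max_left _ _).trans (le_max_left _ _)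
  have h1E : 1 ≤ E * E := by nlinarith
  have hEEle : E ≤ E * E := by nlinarith
  refine ⟨h1E.trans hEE, fun w => ?_, ⟨?_, ?_⟩, ?_, ?_, ?_, ?_⟩
  · have := norm_pos_iff.2 (hQne w a ha a ha)
    positivity
  · simp only [Q, norm_one]; rw [div_le_one hE0]; exact hE1
  · simp only [Q, norm_one]
    calc (1:ℝ) = E * (1 / E) := by field_simp
      _ ≤ _ := by gcongr; linarith
  · intro w x hx y hy
    rw [div_le_iff₀ hE0, mul_comm]; exact hcmp w a ha a ha x hx y hy
  · intro w x hx y hy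
    calc _ ≤ E * ‖S.Q w a a‖ := hcmp w x hx y hy a ha a ha
      _ = E * E * (‖S.Q w a a‖ / E) := by field_simp
      _ ≤ _ := by gcongr
  · intro w x hx y hy x' hx' y' hy'
    have h1 := (hratio2 w x hx y hy x' hx' y' hy').1
    have h2 : S.Q w x y - S.Q w x' y' = (S.Q w x y / S.Q w x' y' - 1) * S.Q w x' y' := by
      have := hQne w x' hx' y' hy'
      field_simp
    rw [h2, norm_mul]
    calc _ ≤ T * E * (‖x - x'‖ + ‖y - y'‖) * (E * ‖S.Q w a a‖) := by
          gcongr; exact hcmp w x' hx' y' hy' a ha a ha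
      _ = (E * E * (T * E)) * (‖S.Q w a a‖ / E) * (‖x - x'‖ + ‖y - y'‖) := by field_simp
      _ ≤ _ := by gcongr; exact (le_max_right _ _).trans (le_max_left _ _)
  · intro x hx y hy
    exact (hDb x (h.2.2.1 hx) y (h.2.2.1 hy)).trans (le_max_right _ _)

end HolIFS

open Filter Topology
namespace HolIFS
variable {S : HolIFS} {A : Set ℂ}

structure Good (S : HolIFS) (A : Set ℂ) (ρ : List (Fin S.m) → ℝ) (C : ℝ) : Prop where
  C1 : 1 ≤ C
  pos : ∀ w, 0 < ρ w
  nil : 1 ≤ C * ρ []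
  lower : ∀ w, ∀ x ∈ A, ∀ y ∈ A, ρ w ≤ ‖S.Q w x y‖
  upper : ∀ w, ∀ x ∈ A, ∀ y ∈ A, ‖S.Q w x y‖ ≤ C * ρ w
  lip : ∀ w, ∀ x ∈ A, ∀ y ∈ A, ∀ x' ∈ A, ∀ y' ∈ A,
    ‖S.Q w x y - S.Q w x' y'‖ ≤ C * ρ w * (‖x - x'‖ + ‖y - y'‖)
  diam : ∀ x ∈ A, ∀ y ∈ A, ‖x - y‖ ≤ C
  bound : ∀ w, ρ w ≤ C
  mul : ∀ v w, ρ (v ++ w) ≤ C * (ρ v * ρ w)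
  mul' : ∀ v w, ρ v * ρ w ≤ C * ρ (v ++ w)
  child : ∀ w i, ρ w ≤ C * ρ (w ++ [i])
  tends : ∀ ε > 0, ∃ N, ∀ w, N ≤ w.length → ρ w < ε
  gap : ∀ w, ∀ x ∈ A, ∀ y ∈ A, (∀ b ∈ A, S.word w b ≠ y) → ρ w ≤ C * ‖S.word w x - y‖

lemma Good.mono {ρ : List (Fin S.m) → ℝ} {C C' : ℝ} (h : S.Good A ρ C) (hC : C ≤ C') :
    S.Good A ρ C' := by
  have hp := h.pos
  constructor
  · exact h.C1.trans hC
  · exact hp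
  · exact h.nil.trans (by gcongr; exact (hp _).le)
  · exact h.lower
  · exact fun w x hx y hy => (h.upper w x hx y hy).trans (by gcongr; exact (hp _).le)
  · exact fun w x hx y hy x' hx' y' hy' => (h.lip w x hx y hy x' hx' y' hy').trans
      (by gcongr; exact (hp _).le)
  · exact fun x hx y hy => (h.diam x hx y hy).trans hC
  · exact fun w => (h.bound w).trans hC
  · exact fun v w => (h.mul v w).trans (by gcongr; exact (mul_pos (hp _) (hp _)).le)
  · exact fun v w => (h.mul' v w).trans (by gcongr; exact (hp _).le)
  · exact fun v i => (h.child v i).trans (by gcongr; exact (hp _).le)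
  · exact h.tends
  · exact fun w x hx y hy hb => (h.gap w x hx y hy hb).trans (by gcongr)

lemma IsAttractor.split (h : S.IsAttractor A) (w : List (Fin S.m)) : ∀ y ∈ A,
    (∀ b ∈ A, S.word w b ≠ y) → ∃ v i v' j, w = v ++ i :: v' ∧ i ≠ j ∧ ∃ b ∈ A, y = S.word v (S.g j b) := by
  induction w with
  | nil => intro y hy hb; exact absurd rfl (hb y hy)
  | cons i w ih =>
    intro y hy hb
    obtain ⟨j, b, hbA, rfl⟩ := h.exists_g hy
    by_cases hij : i = j
    · subst hij
      obtain ⟨v, i', v', j, e, hne, b', hb', e'⟩ := ih b hbA (by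
        rintro c hc rfl
        exact hb c hc (by simp))
      exact ⟨i :: v, i', v', j, by simp [e], hne, b', hb', by simp [e']⟩
    · exact ⟨[], i, w, j, rfl, hij, b, hbA, rfl⟩

set_option maxHeartbeats 1000000 in
lemma IsAttractor.good (h : S.IsAttractor A) (hS : S.SSC A) (hn : A.Nontrivial) :
    ∃ ρ C, S.Good A ρ C := by
  obtain ⟨ρ, C, hc⟩ := h.core
  obtain ⟨γ, hγ, hgap⟩ := h.gap hS
  obtain ⟨lam, h0, h1, C', hC', hb⟩ := h.contr
  obtain ⟨a, ha, b, hbA, hab⟩ := hn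
  have hC1 := hc.C1
  have hC0 : 0 < C := by linarith
  set d := ‖a - b‖ with hd
  have hd0 : 0 < d := norm_pos_iff.2 (sub_ne_zero.2 hab)
  have hp := hc.pos
  have lo : ∀ w, ∀ x ∈ A, ∀ y ∈ A, ρ w * ‖x - y‖ ≤ ‖S.word w x - S.word w y‖ := by
    intro w x hx y hy
    rw [Q_spec, norm_mul]
    gcongr
    exact hc.lower w x hx y hy
  have up : ∀ w, ∀ x ∈ A, ∀ y ∈ A, ‖S.word w x - S.word w y‖ ≤ C * ρ w * ‖x - y‖ := by
    intro w x hx y hy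
    rw [Q_spec, norm_mul]
    gcongr
    exact hc.upper w x hx y hy
  have bound : ∀ w, ρ w ≤ C / d := by
    intro w
    rw [le_div_iff₀ hd0]
    exact (lo w a ha b hbA).trans (hc.diam _ (h.word_mem w ha) _ (h.word_mem w hbA))
  have mul : ∀ v w, ρ (v ++ w) ≤ C ^ 2 * (ρ v * ρ w) := by
    intro v w
    have := lo (v ++ w) a ha b hbA
    rw [word_append, word_append] at this
    have h2 := this.trans (up v _ (h.word_mem w ha) _ (h.word_mem w hbA))
    have h3 := up w a ha b hbA
    have := hp v
    refine le_of_mul_le_mul_right (a := d) ?_ hd0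
    calc _ ≤ _ := h2
      _ ≤ C * ρ v * (C * ρ w * d) := by gcongr
      _ = _ := by ring
  have mul' : ∀ v w, ρ v * ρ w ≤ C * ρ (v ++ w) := by
    intro v w
    have := up (v ++ w) a ha b hbA
    rw [word_append, word_append] at this
    have h2 := (lo v _ (h.word_mem w ha) _ (h.word_mem w hbA)).trans this
    have h3 := lo w a ha b hbA
    have := hp v
    refine le_of_mul_le_mul_right (a := d) ?_ hd0
    calc _ = ρ v * (ρ w * d) := by ring
      _ ≤ ρ v * ‖S.word w a - S.word w b‖ := by gcongr
      _ ≤ _ := h2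
  have hm : Nonempty (Fin S.m) := ⟨⟨0, S.hm⟩⟩
  obtain ⟨i0, hi0⟩ := Finite.exists_min (fun i : Fin S.m => ρ [i])
  set c := ρ [i0] with hcdef
  have hc0 : 0 < c := hp _
  have child : ∀ w i, ρ w ≤ C / c * ρ (w ++ [i]) := by
    intro w i
    have h1 := mul' w [i]
    have h2 : ρ w * c ≤ ρ w * ρ [i] := by have := hp w; gcongr; exact hi0 i
    rw [div_mul_eq_mul_div, le_div_iff₀ hc0]
    linarith
  have tends : ∀ ε > 0, ∃ N, ∀ w : List (Fin S.m), N ≤ w.length → ρ w < ε := by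
    intro ε hε
    obtain ⟨N, hN⟩ := exists_pow_lt_of_lt_one (div_pos hε hC') h1
    refine ⟨N, fun w hw => ?_⟩
    have h2 := (lo w a ha b hbA).trans (hb a ha b hbA w)
    have h3 := le_of_mul_le_mul_right h2 hd0
    calc _ ≤ _ := h3
      _ ≤ C' * lam ^ N := by gcongr 1; exact pow_le_pow_of_le_one h0.le h1.le hw
      _ < C' * (ε / C') := by gcongr
      _ = ε := by field_simp
  have gap : ∀ w, ∀ x ∈ A, ∀ y ∈ A, (∀ b ∈ A, S.word w b ≠ y) →
      ρ w ≤ (C ^ 2 * (C / d) / γ) * ‖S.word w x - y‖ := by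
    intro w x hx y hy hno
    obtain ⟨v, i, v', j, rfl, hij, b', hb', rfl⟩ := h.split w y hy hno
    have h1 := mul v (i :: v')
    have h2 := hgap i j hij (S.word v' x) (h.word_mem v' hx) b' hb'
    have h3 := lo v _ (h.g_mem i (h.word_mem v' hx)) _ (h.g_mem j hb')
    rw [word_append, word_cons]
    have h4 : ρ v * γ ≤ ‖S.word v (S.g i (S.word v' x)) - S.word v (S.g j b')‖ :=
      le_trans (by have := hp v; gcongr) h3
    have hpv := hp v
    calc _ ≤ _ := h1
      _ ≤ C ^ 2 * (ρ v * (C / d)) := by gcongr; exact bound _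
      _ = (C ^ 2 * (C / d) / γ) * (ρ v * γ) := by field_simp
      _ ≤ _ := by gcongr; exact h4
  set X := C + C / d + C ^ 2 + C / c + C ^ 2 * (C / d) / γ with hX
  have p1 : 0 < C / d := by positivity
  have p2 : 0 < C / c := by positivity
  have p3 : 0 < C ^ 2 := by positivity
  have p4 : 0 < C ^ 2 * (C / d) / γ := by positivity
  have hCX : C ≤ X := by rw [hX]; linarith
  refine ⟨ρ, X, ?_⟩
  constructor
  · linarith
  · exact hp
  · exact hc.nil.2.trans (by gcongr; exact (hp _).le)
  · exact hc.lower
  · exact fun w x hx y hy => (hc.upper w x hx y hy).trans (by gcongr; exact (hp _).le)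
  · exact fun w x hx y hy x' hx' y' hy' => (hc.lip w x hx y hy x' hx' y' hy').trans
      (by gcongr; exact (hp _).le)
  · exact fun x hx y hy => (hc.diam x hx y hy).trans hCX
  · exact fun w => (bound w).trans (by rw [hX]; linarith)
  · exact fun v w => (mul v w).trans (by
      gcongr
      · exact (mul_pos (hp _) (hp _)).le
      · rw [hX]; linarith)
  · exact fun v w => (mul' v w).trans (by gcongr; exact (hp _).le)
  · exact fun v i => (child v i).trans (by
      gcongr
      · exact (hp _).le
      · rw [hX]; linarith)
  · exact tends
  · exact fun w x hx y hy hb => (gap w x hx y hy hb).trans (by gcongr; rw [hX]; linarith)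

namespace Good
variable {ρ : List (Fin S.m) → ℝ} {C : ℝ}

lemma lo (hc : S.Good A ρ C) : ∀ w, ∀ x ∈ A, ∀ y ∈ A, ρ w * ‖x - y‖ ≤ ‖S.word w x - S.word w y‖ := by
  intro w x hx y hy
  rw [Q_spec, norm_mul]
  gcongr
  exact hc.lower w x hx y hy

lemma up (hc : S.Good A ρ C) : ∀ w, ∀ x ∈ A, ∀ y ∈ A, ‖S.word w x - S.word w y‖ ≤ C * ρ w * ‖x - y‖ := by
  intro w x hx y hy
  rw [Q_spec, norm_mul]
  gcongr
  exact hc.upper w x hx y hy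

lemma deep (hc : S.Good A ρ C) (w : List (Fin S.m)) : 1 ≤ C ^ (w.length + 1) * ρ w := by
  have hC : 0 < C := by linarith [hc.C1]
  induction w using List.reverseRecOn with
  | nil => simpa using hc.nil
  | append_singleton w i ih =>
    refine ih.trans ?_
    rw [List.length_append, List.length_singleton, pow_succ _ (w.length + 1), mul_assoc]
    gcongr
    exact hc.child w i

lemma scale (hc : S.Good A ρ C) (h : S.IsAttractor A) {z : ℂ} (hz : z ∈ A) {τ : ℝ} (hτ : 0 < τ)
    (hτ1 : C * τ ≤ 1) : ∃ s, ∃ b ∈ A, S.word s b = z ∧ τ ≤ ρ s ∧ ρ s ≤ C * τ := by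
  have hC : 0 < C := by linarith [hc.C1]
  obtain ⟨N, hN⟩ := hc.tends τ hτ
  by_contra hno
  push Not at hno
  have : ∀ n, ∃ s : List (Fin S.m), s.length = n ∧ ∃ b ∈ A, S.word s b = z ∧ τ ≤ ρ s := by
    intro n
    induction n with
    | zero =>
      refine ⟨[], rfl, z, hz, rfl, ?_⟩
      exact le_of_mul_le_mul_left (hτ1.trans hc.nil) hC
    | succ n ih =>
      obtain ⟨s, hs, b, hb, e, hτs⟩ := ih
      obtain ⟨i, b', hb', rfl⟩ := h.exists_g hb
      refine ⟨s ++ [i], by simp [hs], b', hb', by rw [word_append]; simpa using e, ?_⟩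
      have h1 := hno s _ hb e hτs
      have h2 := hc.child s i
      exact (lt_of_mul_lt_mul_left (h1.trans_le h2) hC.le).le
  obtain ⟨s, hs, b, hb, e, hτs⟩ := this N
  exact absurd (hN s hs.ge) (not_lt.2 hτs)
end Good
end HolIFS

open Filter Topology
namespace HolIFS
variable {G F : HolIFS} {A : Set ℂ} {ρG : List (Fin G.m) → ℝ} {ρF : List (Fin F.m) → ℝ} {C c : ℝ}

/-- choice of a comparable word -/
lemma exists_comparable (hG : G.IsAttractor A) (hF : F.IsAttractor A) (gG : G.Good A ρG C)
    (gF : F.Good A ρF C) {a b : ℂ} (ha : a ∈ A) (hb : b ∈ A) (hab : a ≠ b) (t : List (Fin G.m)) :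
    ∃ u : List (Fin F.m), (∀ z ∈ A, ∃ y ∈ A, F.word u y = G.word t z) ∧
      ρF u ≤ C ^ 4 * ρG t ∧ ρG t ≤ C ^ 2 / ‖a - b‖ * ρF u := by
  have hC1 := gG.C1
  have hC : 0 < C := by linarith
  have hd0 : 0 < ‖a - b‖ := norm_pos_iff.2 (sub_ne_zero.2 hab)
  have hsec : ∀ u : List (Fin F.m), (∀ z ∈ A, ∃ y ∈ A, F.word u y = G.word t z) →
      ρG t ≤ C ^ 2 / ‖a - b‖ * ρF u := by
    intro u hu
    obtain ⟨y, hy, e⟩ := hu a ha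
    obtain ⟨y', hy', e'⟩ := hu b hb
    have h1 := gG.lo t a ha b hb
    rw [← e, ← e'] at h1
    have h2 := h1.trans (gF.up u y hy y' hy')
    have h3 := gF.diam y hy y' hy'
    have hp := gF.pos u
    rw [div_mul_eq_mul_div, le_div_iff₀ hd0]
    calc _ ≤ _ := h2
      _ ≤ C * ρF u * C := by gcongr
      _ = _ := by ring
  by_contra hno
  push Not at hno
  have key : ∀ n, ∃ u : List (Fin F.m), u.length = n ∧ (∀ z ∈ A, ∃ y ∈ A, F.word u y = G.word t z) := by
    intro n
    induction n with
    | zero => exact ⟨[], rfl, fun z hz => ⟨_, hG.word_mem t hz, rfl⟩⟩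
    | succ n ih =>
      obtain ⟨u, hu, hall⟩ := ih
      have h1 : C ^ 4 * ρG t < ρF u := by
        by_contra hle
        exact absurd (hsec u hall) (not_le.2 (hno u hall (not_lt.1 hle)))
      obtain ⟨y, hy, e⟩ := hall a ha
      obtain ⟨i, y', hy', rfl⟩ := hF.exists_g hy
      have e' : F.word (u ++ [i]) y' = G.word t a := by rw [word_append]; simpa using e
      refine ⟨u ++ [i], by simp [hu], ?_⟩
      by_contra hz
      push Not at hz
      obtain ⟨z, hz, hzn⟩ := hz
      have h2 := gF.gap (u ++ [i]) y' hy' (G.word t z) (hG.word_mem t hz) hzn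
      rw [e'] at h2
      have h3 := gG.up t a ha z hz
      have h4 := gG.diam a ha z hz
      have h5 := gF.child u i
      have hp := gG.pos t
      have : ρF u ≤ C ^ 4 * ρG t := by
        calc ρF u ≤ C * ρF (u ++ [i]) := h5
          _ ≤ C * (C * (C * ρG t * C)) := by
            gcongr
            refine h2.trans ?_
            gcongr
            refine h3.trans ?_
            gcongr
          _ = _ := by ring
      linarith
  obtain ⟨N, hN⟩ := gF.tends (ρG t / (C ^ 2 / ‖a - b‖)) (by have := gG.pos t; positivity)
  obtain ⟨u, hu, hall⟩ := key N
  have h1 := hN u hu.ge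
  have h2 := hsec u hall
  rw [lt_div_iff₀ (by positivity)] at h1
  linarith

structure Adm (G F : HolIFS) (A : Set ℂ) (ρG : List (Fin G.m) → ℝ) (ρF : List (Fin F.m) → ℝ) (c : ℝ)
    (t : List (Fin G.m)) (u : List (Fin F.m)) (φ : ℂ → ℂ) : Prop where
  tne : t ≠ []
  une : u ≠ []
  maps : ∀ z ∈ A, φ z ∈ A
  eq : ∀ z ∈ A, F.word u (φ z) = G.word t z
  le1 : ρG t ≤ c * ρF u
  le2 : ρF u ≤ c * ρG t

noncomputable def Phi (G F : HolIFS) (t : List (Fin G.m)) (u : List (Fin F.m)) (φ : ℂ → ℂ) (x y : ℂ) : ℂ :=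
  G.Q t x y / F.Q u (φ x) (φ y)

namespace Adm
variable {t : List (Fin G.m)} {u : List (Fin F.m)} {φ : ℂ → ℂ}

lemma Q_ne (p : Adm G F A ρG ρF c t u φ) (gF : F.Good A ρF C) {x y : ℂ} (hx : x ∈ A) (hy : y ∈ A) :
    F.Q u (φ x) (φ y) ≠ 0 := by
  have := gF.lower u _ (p.maps x hx) _ (p.maps y hy)
  exact norm_pos_iff.1 ((gF.pos u).trans_le this)

lemma phi_sub (p : Adm G F A ρG ρF c t u φ) (gF : F.Good A ρF C) {x y : ℂ} (hx : x ∈ A) (hy : y ∈ A) :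
    φ x - φ y = Phi G F t u φ x y * (x - y) := by
  have h := p.Q_ne gF hx hy
  have e := F.Q_spec u (φ x) (φ y)
  rw [p.eq x hx, p.eq y hy, G.Q_spec] at e
  rw [Phi, div_mul_eq_mul_div, e]
  field_simp

lemma Phi_le (p : Adm G F A ρG ρF c t u φ) (gG : G.Good A ρG C) (gF : F.Good A ρF C) {x y : ℂ}
    (hx : x ∈ A) (hy : y ∈ A) : ‖Phi G F t u φ x y‖ ≤ C * c := by
  have hC : 0 < C := by linarith [gG.C1]
  have hp := gF.pos u
  have h1 := gF.lower u _ (p.maps x hx) _ (p.maps y hy)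
  rw [Phi, norm_div, div_le_iff₀ (hp.trans_le h1)]
  have hc : 0 < c := by
    by_contra hc
    have := p.le1
    have := gG.pos t
    nlinarith
  calc _ ≤ C * ρG t := gG.upper t x hx y hy
    _ ≤ C * (c * ρF u) := by gcongr; exact p.le1
    _ = C * c * ρF u := by ring
    _ ≤ _ := by gcongr

lemma phi_lip (p : Adm G F A ρG ρF c t u φ) (gG : G.Good A ρG C) (gF : F.Good A ρF C) {x y : ℂ}
    (hx : x ∈ A) (hy : y ∈ A) : ‖φ x - φ y‖ ≤ C * c * ‖x - y‖ := by
  rw [p.phi_sub gF hx hy, norm_mul]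
  gcongr
  exact p.Phi_le gG gF hx hy

lemma Phi_lip (p : Adm G F A ρG ρF c t u φ) (gG : G.Good A ρG C) (gF : F.Good A ρF C) {x y x' y' : ℂ}
    (hx : x ∈ A) (hy : y ∈ A) (hx' : x' ∈ A) (hy' : y' ∈ A) :
    ‖Phi G F t u φ x y - Phi G F t u φ x' y'‖ ≤ (C * c + C * c * (C * (C * c))) * (‖x - x'‖ + ‖y - y'‖) := by
  have hC : 0 < C := by linarith [gG.C1]
  have hp := gF.pos u
  have hpG := gG.pos t
  have hc : 0 < c := by
    by_contra hc
    have := p.le1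
    nlinarith
  have n1 := p.Q_ne gF hx hy
  have n2 := p.Q_ne gF hx' hy'
  have e : Phi G F t u φ x y - Phi G F t u φ x' y' =
      ((G.Q t x y - G.Q t x' y') - Phi G F t u φ x' y' * (F.Q u (φ x) (φ y) - F.Q u (φ x') (φ y'))) / F.Q u (φ x) (φ y) := by
    unfold Phi; field_simp; ring
  have h1 := gF.lower u _ (p.maps x hx) _ (p.maps y hy)
  rw [e, norm_div, div_le_iff₀ (hp.trans_le h1)]
  have l1 := gG.lip t x hx y hy x' hx' y' hy'
  have l2 := gF.lip u _ (p.maps x hx) _ (p.maps y hy) _ (p.maps x' hx') _ (p.maps y' hy')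
  have l3 := p.phi_lip gG gF hx hx'
  have l4 := p.phi_lip gG gF hy hy'
  have l5 := p.Phi_le gG gF hx' hy'
  set d := ‖x - x'‖ + ‖y - y'‖ with hd
  have hd0 : 0 ≤ d := by positivity
  have l6 : ‖φ x - φ x'‖ + ‖φ y - φ y'‖ ≤ C * c * d := by rw [hd, mul_add]; linarith
  calc _ ≤ ‖G.Q t x y - G.Q t x' y'‖ + ‖Phi G F t u φ x' y'‖ * ‖F.Q u (φ x) (φ y) - F.Q u (φ x') (φ y')‖ := by
        rw [← norm_mul]; exact norm_sub_le _ _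
    _ ≤ C * (c * ρF u) * d + C * c * (C * ρF u * (C * c * d)) := by
        gcongr
        · refine l1.trans ?_
          gcongr
          exact p.le1
        · refine l2.trans ?_
          gcongr
    _ = (C * c + C * c * (C * (C * c))) * d * ρF u := by ring
    _ ≤ _ := by gcongr
end Adm

end HolIFS

open Filter Topology
namespace HolIFS
variable {G F : HolIFS} {A : Set ℂ} {ρG : List (Fin G.m) → ℝ} {ρF : List (Fin F.m) → ℝ} {C c : ℝ}

set_option maxHeartbeats 1000000 in
lemma rigidity (hG : G.IsAttractor A) (hF : F.IsAttractor A) (gG : G.Good A ρG C)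
    (gF : F.Good A ρF C) (hc : 1 ≤ c) : ∃ ε > 0, ∀ t1 u1 φ1 t2 u2 φ2,
    Adm G F A ρG ρF c t1 u1 φ1 → Adm G F A ρG ρF c t2 u2 φ2 →
    (∀ z ∈ A, ‖φ1 z - φ2 z‖ ≤ ε ∧ ‖Phi G F t1 u1 φ1 z z - Phi G F t2 u2 φ2 z z‖ ≤ ε) →
    ∀ z ∈ A, φ1 z = φ2 z := by
  have hC1 := gG.C1
  have hC : 0 < C := by linarith
  have hc0 : 0 < c := by linarith
  set κ := 2 * C ^ 3 * c with hκ
  set L := C * c + C * c * (C * (C * c)) with hL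
  have hκ0 : 0 < κ := by positivity
  have hL0 : 0 < L := by positivity
  set E1 := C ^ 3 * κ * (1 + 2 * L * (C ^ 3 * κ)) with hE1
  have hE10 : 0 < E1 := by positivity
  refine ⟨min (1 / (2 * E1)) (1 / (C * κ)), by positivity, ?_⟩
  set ε := min (1 / (2 * E1)) (1 / (C * κ)) with hε
  have ε1 : ε * (2 * E1) ≤ 1 := by
    rw [← le_div_iff₀ (by positivity)]; exact min_le_left _ _
  have ε2 : ε * (C * κ) ≤ 1 := by
    rw [← le_div_iff₀ (by positivity)]; exact min_le_right _ _
  intro t1 u1 φ1 t2 u2 φ2 p1 p2 hclose z0 hz0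
  by_contra hne
  set η := φ1 z0 - φ2 z0 with hη
  have hη0 : 0 < ‖η‖ := norm_pos_iff.2 (sub_ne_zero.2 hne)
  have hηε : ‖η‖ ≤ ε := (hclose z0 hz0).1
  have hΦ0 := (hclose z0 hz0).2
  obtain ⟨s, zh, hzh, ez, hs1, hs2⟩ := gG.scale hG hz0 (τ := κ * ‖η‖) (by positivity) (by
    calc C * (κ * ‖η‖) ≤ C * (κ * ε) := by gcongr
      _ = ε * (C * κ) := by ring
      _ ≤ 1 := ε2)
  have hsA : ∀ x ∈ A, G.word s x ∈ A := fun x hx => hG.word_mem s hx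
  -- closeness on B
  have hδ : ∀ x ∈ A, ‖φ2 (G.word s x) - φ1 (G.word s x) + η‖ ≤ ‖η‖ / 2 := by
    intro x hx
    have hb := hsA x hx
    set b := G.word s x with hbdef
    have hbz : ‖b - z0‖ ≤ C ^ 3 * κ * ‖η‖ := by
      rw [← ez, hbdef]
      calc _ ≤ C * ρG s * ‖x - zh‖ := gG.up s x hx zh hzh
        _ ≤ C * (C * (κ * ‖η‖)) * C := by
          gcongr
          exact gG.diam x hx zh hzh
        _ = _ := by ring
    have e1 : φ2 b - φ1 b + η = (Phi G F t2 u2 φ2 b z0 - Phi G F t1 u1 φ1 b z0) * (b - z0) := by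
      rw [sub_mul, ← p1.phi_sub gF hb hz0, ← p2.phi_sub gF hb hz0, hη]; ring
    have l1 := p1.Phi_lip gG gF hb hz0 hz0 hz0
    have l2 := p2.Phi_lip gG gF hb hz0 hz0 hz0
    rw [sub_self, norm_zero, add_zero, ← hL] at l1 l2
    have l3 : ‖Phi G F t2 u2 φ2 b z0 - Phi G F t1 u1 φ1 b z0‖ ≤ ε + 2 * L * ‖b - z0‖ := by
      have : Phi G F t2 u2 φ2 b z0 - Phi G F t1 u1 φ1 b z0 =
        (Phi G F t2 u2 φ2 b z0 - Phi G F t2 u2 φ2 z0 z0) - (Phi G F t1 u1 φ1 b z0 - Phi G F t1 u1 φ1 z0 z0)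
        - (Phi G F t1 u1 φ1 z0 z0 - Phi G F t2 u2 φ2 z0 z0) := by ring
      rw [this]
      refine (norm_sub_le _ _).trans ?_
      have := norm_sub_le (Phi G F t2 u2 φ2 b z0 - Phi G F t2 u2 φ2 z0 z0) (Phi G F t1 u1 φ1 b z0 - Phi G F t1 u1 φ1 z0 z0)
      linarith
    rw [e1, norm_mul]
    have hε0 : 0 < ε := hη0.trans_le hηε
    calc _ ≤ (ε + 2 * L * (C ^ 3 * κ * ε)) * (C ^ 3 * κ * ‖η‖) := by
          gcongr
          refine l3.trans ?_
          gcongr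
          refine hbz.trans ?_
          gcongr
      _ = ε * (2 * E1) * (‖η‖ / 2) := by rw [hE1]; ring
      _ ≤ 1 * (‖η‖ / 2) := by gcongr
      _ = _ := by ring
  -- φ2 B ⊆ φ1 B
  have hsub : ∀ x ∈ A, ∃ y ∈ A, φ1 (G.word s y) = φ2 (G.word s x) := by
    intro x hx
    have hb := hsA x hx
    by_cases hex : ∃ y ∈ A, G.word (t1 ++ s) y = F.word u1 (φ2 (G.word s x))
    · obtain ⟨y, hy, e⟩ := hex
      refine ⟨y, hy, ?_⟩
      rw [word_append, ← p1.eq _ (hsA y hy)] at e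
      exact F.word_inj u1 (hF.2.2.1 (p1.maps _ (hsA y hy))) (hF.2.2.1 (p2.maps _ hb)) e
    · exfalso
      push Not at hex
      have h1 := gG.gap (t1 ++ s) x hx _ (hF.word_mem u1 (p2.maps _ hb)) hex
      rw [word_append, ← p1.eq _ hb] at h1
      have h2 := gF.up u1 _ (p1.maps _ hb) _ (p2.maps _ hb)
      have h3 : ‖φ1 (G.word s x) - φ2 (G.word s x)‖ ≤ 3 / 2 * ‖η‖ := by
        have e : φ1 (G.word s x) - φ2 (G.word s x) = η - (φ2 (G.word s x) - φ1 (G.word s x) + η) := by ring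
        rw [e]
        have := norm_sub_le η (φ2 (G.word s x) - φ1 (G.word s x) + η)
        have := hδ x hx
        linarith
      have h4 := gG.mul' t1 s
      have pF := gF.pos u1
      have pG := gG.pos t1
      have h5 : ρG t1 * (κ * ‖η‖) ≤ C * (C * (C * (c * ρG t1) * (3 / 2 * ‖η‖))) := by
        calc _ ≤ ρG t1 * ρG s := by gcongr
          _ ≤ _ := h4
          _ ≤ _ := by
            gcongr
            refine h1.trans ?_
            gcongr
            refine h2.trans ?_
            gcongr
            exact p1.le2
      have h6 : 0 < C ^ 3 * c * ρG t1 * ‖η‖ := by positivity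
      rw [hκ] at h5
      nlinarith
  -- maximum
  have hcont : ContinuousOn (fun x => -(φ1 (G.word s x) * (starRingEnd ℂ) η).re) A := by
    have h1 : ContinuousOn φ1 A := by
      refine LipschitzOnWith.continuousOn (K := (C * c).toNNReal) (LipschitzOnWith.of_dist_le_mul ?_)
      intro x hx y hy
      rw [Real.coe_toNNReal _ (by positivity), dist_eq_norm, dist_eq_norm]
      exact p1.phi_lip gG gF hx hy
    have h2 : ContinuousOn (fun x => φ1 (G.word s x)) A :=
      h1.comp ((G.word_cont s).mono hG.2.2.1) hsA
    exact (Complex.continuous_re.comp_continuousOn (h2.mul continuousOn_const)).neg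
  obtain ⟨x, hx, hmax⟩ := hG.2.1.exists_isMaxOn hG.1 hcont
  obtain ⟨y, hy, e⟩ := hsub x hx
  have h1 : -(φ1 (G.word s y) * (starRingEnd ℂ) η).re ≤ -(φ1 (G.word s x) * (starRingEnd ℂ) η).re := hmax hy
  have h2 := hδ x hx
  set w := φ2 (G.word s x) - φ1 (G.word s x) + η with hw
  have e2 : φ1 (G.word s y) = φ1 (G.word s x) + w - η := by rw [e, hw]; ring
  rw [e2, sub_mul, add_mul, Complex.sub_re, Complex.add_re, Complex.mul_conj'] at h1
  have h3 : (w * (starRingEnd ℂ) η).re ≤ ‖η‖ / 2 * ‖η‖ := by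
    refine (Complex.re_le_norm _).trans ?_
    rw [norm_mul, RCLike.norm_conj]
    gcongr
  have h4 : (((‖η‖ : ℂ)) ^ 2).re = ‖η‖ ^ 2 := by norm_cast
  rw [h4] at h1
  nlinarith

lemma finiteness (hG : G.IsAttractor A) (hF : F.IsAttractor A) (gG : G.Good A ρG C)
    (gF : F.Good A ρF C) (hc : 1 ≤ c) :
    ∃ R : Finset (List (Fin G.m) × List (Fin F.m)), (∀ q ∈ R, q.1 ≠ [] ∧ q.2 ≠ []) ∧
    ∀ t u φ, Adm G F A ρG ρF c t u φ → ∃ q ∈ R, ∀ z ∈ A, F.word q.2 (φ z) = G.word q.1 z := by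
  classical
  have hC1 := gG.C1
  have hC : 0 < C := by linarith
  have hc0 : 0 < c := by linarith
  obtain ⟨ε, hε, hrig⟩ := rigidity hG hF gG gF hc
  set L := C * c + C * c * (C * (C * c)) with hL
  have hL0 : 0 < L := by positivity
  have hLC : C * c ≤ L := by rw [hL]; have : 0 < C * c * (C * (C * c)) := by positivity
                             linarith
  obtain ⟨N, hNA, hNf, hN⟩ := hG.2.1.totallyBounded.exists_subset (Metric.dist_mem_uniformity (ε := ε / (6 * L)) (by positivity))
  have : Fintype N := hNf.fintype
  let P := {p : List (Fin G.m) × List (Fin F.m) × (ℂ → ℂ) // Adm G F A ρG ρF c p.1 p.2.1 p.2.2}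
  let e : P → (N → ℂ × ℂ) := fun p n => (p.1.2.2 n, Phi G F p.1.1 p.1.2.1 p.1.2.2 n n)
  obtain ⟨D, hD⟩ := hG.2.1.isBounded.exists_norm_le
  have hbd : Bornology.IsBounded (range e) := by
    rw [isBounded_iff_forall_norm_le]
    refine ⟨max (max D (C * c)) 0, ?_⟩
    rintro _ ⟨p, rfl⟩
    rw [pi_norm_le_iff_of_nonneg (le_max_right _ _)]
    intro n
    rw [Prod.norm_def]
    refine le_trans (max_le_max ?_ ?_) (le_max_left _ _)
    · exact hD _ (p.2.maps _ (hNA n.2))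
    · exact p.2.Phi_le gG gF (hNA n.2) (hNA n.2)
  obtain ⟨T, hTs, hTf, hT⟩ := (hbd.isCompact_closure.totallyBounded.subset subset_closure).exists_subset (Metric.dist_mem_uniformity (ε := ε / 3) (by positivity))
  rcases isEmpty_or_nonempty P with hP | hP
  · exact ⟨∅, by simp, fun t u φ p => (hP.false ⟨(t, u, φ), p⟩).elim⟩
  have hTs' : ∀ y ∈ T, ∃ p, e p = y := fun y hy => hTs hy
  choose! r hr using hTs'
  refine ⟨hTf.toFinset.image (fun y => ((r y).1.1, (r y).1.2.1)), ?_, ?_⟩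
  · intro q hq
    obtain ⟨y, hy, rfl⟩ := Finset.mem_image.1 hq
    exact ⟨(r y).2.tne, (r y).2.une⟩
  · intro t u φ p
    have := hT (mem_range_self (⟨(t, u, φ), p⟩ : P))
    simp only [mem_iUnion] at this
    obtain ⟨y, hy, hdist⟩ := this
    change dist _ _ < _ at hdist
    refine ⟨_, Finset.mem_image.2 ⟨y, hTf.mem_toFinset.2 hy, rfl⟩, ?_⟩
    have q := (r y).2
    have hry := hr y hy
    rw [← hry] at hdist
    have heq : ∀ z ∈ A, φ z = (r y).1.2.2 z := by
      refine hrig _ _ _ _ _ _ p q ?_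
      intro z hz
      have := hN hz
      simp only [mem_iUnion] at this
      obtain ⟨n, hn, hzn⟩ := this
      change dist _ _ < _ at hzn
      rw [dist_eq_norm, lt_div_iff₀ (by positivity)] at hzn
      have hd2 := (dist_le_pi_dist _ _ (⟨n, hn⟩ : N)).trans hdist.le
      rw [Prod.dist_eq, max_le_iff, dist_eq_norm, dist_eq_norm] at hd2
      obtain ⟨k1, k2⟩ := hd2
      change ‖φ n - (r y).1.2.2 n‖ ≤ _ at k1
      change ‖Phi G F t u φ n n - Phi G F (r y).1.1 (r y).1.2.1 (r y).1.2.2 n n‖ ≤ _ at k2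
      have hnA := hNA hn
      have a1 := p.phi_lip gG gF hz hnA
      have a2 := q.phi_lip gG gF hz hnA
      have b1 := p.Phi_lip gG gF hz hz hnA hnA
      have b2 := q.Phi_lip gG gF hz hz hnA hnA
      rw [← hL] at b1 b2
      have hnn := norm_nonneg (z - n)
      have hm : C * c * ‖z - n‖ ≤ L * ‖z - n‖ := by gcongr
      have gen : ∀ a b a' b' : ℂ, ‖a - b‖ ≤ ‖a - a'‖ + ‖b - b'‖ + ‖a' - b'‖ := by
        intro a b a' b'
        have : a - b = (a - a') - (b - b') + (a' - b') := by ring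
        rw [this]
        have h1 := norm_add_le ((a - a') - (b - b')) (a' - b')
        have h2 := norm_sub_le (a - a') (b - b')
        linarith
      constructor
      · have := gen (φ z) ((r y).1.2.2 z) (φ n) ((r y).1.2.2 n)
        linarith
      · have := gen (Phi G F t u φ z z) (Phi G F (r y).1.1 (r y).1.2.1 (r y).1.2.2 z z) (Phi G F t u φ n n)
          (Phi G F (r y).1.1 (r y).1.2.1 (r y).1.2.2 n n)
        linarith
    intro z hz
    rw [heq z hz]
    exact q.eq z hz

lemma main_fin (hG : G.IsAttractor A) (hF : F.IsAttractor A) (sG : G.SSC A) (sF : F.SSC A)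
    (hn : A.Nontrivial) : ∃ R : Finset (List (Fin G.m) × List (Fin F.m)),
    (∀ q ∈ R, q.1 ≠ [] ∧ q.2 ≠ []) ∧ ∀ N, ∃ M0, ∀ t : List (Fin G.m), M0 ≤ t.length →
      ∃ u : List (Fin F.m), N ≤ u.length ∧ ∃ q ∈ R, ∀ z ∈ A, ∃ y ∈ A,
        F.word q.2 y = G.word q.1 z ∧ F.word u y = G.word t z := by
  obtain ⟨ρG, CG, gG⟩ := hG.good sG hn
  obtain ⟨ρF, CF, gF⟩ := hF.good sF hn
  replace gG := gG.mono (le_max_left CG CF)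
  replace gF := gF.mono (le_max_right CG CF)
  set C := max CG CF
  obtain ⟨a, ha, b, hb, hab⟩ := hn
  have hC1 := gG.C1
  have hC : 0 < C := by linarith
  have hd0 : 0 < ‖a - b‖ := norm_pos_iff.2 (sub_ne_zero.2 hab)
  set c := max 1 (max (C ^ 4) (C ^ 2 / ‖a - b‖)) with hc
  obtain ⟨R, hR, hfin⟩ := finiteness hG hF gG gF (c := c) (le_max_left _ _)
  refine ⟨R, hR, fun N => ?_⟩
  obtain ⟨M0, hM0⟩ := gG.tends (1 / (C ^ 4 * C ^ (max N 1 + 1))) (by positivity)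
  refine ⟨max M0 1, fun t ht => ?_⟩
  obtain ⟨u, hu, l1, l2⟩ := exists_comparable hG hF gG gF ha hb hab t
  have hlen : max N 1 ≤ u.length := by
    by_contra hlt
    push Not at hlt
    have h1 := hM0 t ((le_max_left _ _).trans ht)
    have h2 := gF.deep u
    rw [lt_div_iff₀ (by positivity)] at h1
    have : C ^ (u.length + 1) * ρF u ≤ C ^ (max N 1 + 1) * (C ^ 4 * ρG t) := by
      have := gG.pos t
      have := gF.pos u
      gcongr
    nlinarith
  choose! φ hφA hφ using hu
  have adm : Adm G F A ρG ρF c t u φ := by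
    refine ⟨?_, ?_, hφA, hφ, l2.trans ?_, l1.trans ?_⟩
    · rintro rfl; simp at ht
    · rintro rfl; simp at hlen
    · have := gF.pos u
      gcongr
      exact (le_max_right _ _).trans (le_max_right _ _)
    · have := gG.pos t
      gcongr
      exact (le_max_left _ _).trans (le_max_right _ _)
  obtain ⟨q, hq, e⟩ := hfin t u φ adm
  exact ⟨u, (le_max_left _ _).trans hlen, q, hq, fun z hz => ⟨φ z, hφA z hz, e z hz, hφ z hz⟩⟩
end HolIFS

open Filter Topology
namespace HolIFS
variable {S G F : HolIFS} {A : Set ℂ}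

lemma IsBoxLike.word_mem {V : Set ℂ} (hV : S.IsBoxLike A V) (w : List (Fin S.m)) {z : ℂ} (hz : z ∈ V) :
    S.word w z ∈ V := by
  induction w with
  | nil => exact hz
  | cons i v ih => exact hV.2.2.2.1 i (subset_closure ⟨_, ih, rfl⟩)

lemma IsBoxLike.prefix {V : Set ℂ} (hV : S.IsBoxLike A V) {y y' : ℂ} (hy : y ∈ V) (hy' : y' ∈ V)
    (a : List (Fin S.m)) : ∀ b : List (Fin S.m), a.length ≤ b.length → S.word a y = S.word b y' →
    ∃ b', b = a ++ b' ∧ y = S.word b' y' := by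
  induction a with
  | nil => exact fun b _ e => ⟨b, rfl, e⟩
  | cons i a ih =>
    rintro (_ | ⟨j, b⟩) hl e
    · simp at hl
    · rw [word_cons, word_cons] at e
      change S.g i (S.word a y) = S.g j (S.word b y') at e
      have h1 := hV.word_mem a hy
      have h2 := hV.word_mem b hy'
      have hij : i = j := by
        by_contra hne
        exact Set.disjoint_left.1 (hV.2.2.2.2 i j hne) (subset_closure ⟨_, h1, rfl⟩)
          (e ▸ subset_closure ⟨_, h2, rfl⟩)
      subst hij
      obtain ⟨b', hb', e'⟩ := ih b (by simpa using hl) (S.hinj i (hV.2.1 h1) (hV.2.1 h2) e)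
      exact ⟨b', by simp [hb'], e'⟩

lemma sub_of_side {Ag Af VG VF : Set ℂ} (hAg : G.IsAttractor Ag) (hAf : F.IsAttractor Af)
    (hVG : G.IsBoxLike Ag VG) (hVF : F.IsBoxLike Af VF) {K : ℕ} {tk : Fin K → List (Fin G.m)}
    {uk : Fin K → List (Fin F.m)} {Ms M : ℕ} (hMs : ∀ k, (uk k).length ≤ Ms)
    (h : GFinSide G F Ag VG VF K tk uk Ms M) : Ag ⊆ Af := by
  have key : ∀ n, ∀ w ∈ Ag, ∃ v : List (Fin F.m), n ≤ v.length ∧ ∃ y ∈ VF, F.word v y = w := by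
    have step : ∀ n, (∀ w ∈ Ag, ∃ v : List (Fin F.m), n + Ms ≤ v.length ∧ ∃ y ∈ VF, F.word v y = w) →
        ∀ w ∈ Ag, ∃ v : List (Fin F.m), n + 1 + Ms ≤ v.length ∧ ∃ y ∈ VF, F.word v y = w := by
      intro n ih w hw
      obtain ⟨s, hs, z, hz, rfl⟩ := hAg.exists_word M hw
      obtain ⟨u, k, hu, hall⟩ := h z (hVG.2.2.1 hz) s hs
      obtain ⟨y, hy, e1, e2⟩ := hall z ⟨mem_connectedComponentIn (hVG.2.2.1 hz), hz⟩
      obtain ⟨v, hv, y', hy', e3⟩ := ih _ (hAg.word_mem (tk k) hz)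
      obtain ⟨v', hv', e4⟩ := hVF.prefix hy hy' (uk k) v ((hMs k).trans (by omega)) (e1.trans e3.symm)
      refine ⟨u ++ v', ?_, y', hy', ?_⟩
      · rw [hv', List.length_append] at hv
        have := hMs k
        rw [List.length_append]
        omega
      · rw [word_append, ← e4, e2]
    have base : ∀ w ∈ Ag, ∃ v : List (Fin F.m), 0 + Ms ≤ v.length ∧ ∃ y ∈ VF, F.word v y = w := by
      intro w hw
      obtain ⟨s, hs, z, hz, rfl⟩ := hAg.exists_word M hw
      obtain ⟨u, k, hu, hall⟩ := h z (hVG.2.2.1 hz) s hs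
      obtain ⟨y, hy, e1, e2⟩ := hall z ⟨mem_connectedComponentIn (hVG.2.2.1 hz), hz⟩
      exact ⟨u, by omega, y, hy, e2⟩
    intro n w hw
    have all : ∀ n, ∀ w ∈ Ag, ∃ v : List (Fin F.m), n + Ms ≤ v.length ∧ ∃ y ∈ VF, F.word v y = w := by
      intro n
      induction n with
      | zero => exact base
      | succ n ih => exact step n ih
    obtain ⟨v, hv, r⟩ := all n w hw
    exact ⟨v, by omega, r⟩
  intro w hw
  refine hAf.mem_of_deep (fun n => ?_)
  obtain ⟨v, hv, y, hy, e⟩ := key n w hw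
  exact ⟨v, hv, y, hVF.2.1 hy, e⟩
end HolIFS

end Helpers

/-- Theorem ((I) ⇔ (III)): two holomorphic IFS `G`, `F` with the SSC share the same
attractor iff there are box-like restrictions `(G, V_G)`, `(F, V_F)`, finitely many words
`t^k ∈ Λ*`, `u^k ∈ Λ̃*`, `k = 1, …, K`, and `M ≥ M* + 1`, where
`M* = max {|t^k|, |u^k|}`, satisfying the finite systems of functional equations
(G_fin) and (F_fin). -/
theorem stmt_13 (G F : HolIFS) (Ag Af : Set ℂ)
    (hAg : G.IsAttractor Ag) (hAg2 : Ag.Nontrivial) (hSSCg : G.SSC Ag)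
    (hAf : F.IsAttractor Af) (hAf2 : Af.Nontrivial) (hSSCf : F.SSC Af) :
    Ag = Af ↔
      ∃ (VG VF : Set ℂ), G.IsBoxLike Ag VG ∧ F.IsBoxLike Af VF ∧
        ∃ (K : ℕ), 1 ≤ K ∧
          ∃ (tk : Fin K → List (Fin G.m)) (uk : Fin K → List (Fin F.m)) (M : ℕ),
            (∀ k, tk k ≠ [] ∧ uk k ≠ []) ∧
            (Finset.univ.sup (fun k => max (tk k).length (uk k).length)) + 1 ≤ M ∧
            GFinSide G F Ag VG VF K tk uk
              (Finset.univ.sup (fun k => max (tk k).length (uk k).length)) M ∧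
            GFinSide F G Af VF VG K uk tk
              (Finset.univ.sup (fun k => max (tk k).length (uk k).length)) M := by
  constructor
  · intro hEq
    subst hEq
    obtain ⟨VG, hVG⟩ := hAg.exists_box hSSCg
    obtain ⟨VF, hVF⟩ := hAf.exists_box hSSCf
    refine ⟨VG, VF, hVG, hVF, ?_⟩
    obtain ⟨R1, hR1, h1⟩ := HolIFS.main_fin hAg hAf hSSCg hSSCf hAg2
    obtain ⟨R2, hR2, h2⟩ := HolIFS.main_fin hAf hAg hSSCf hSSCg hAg2
    let l : List (List (Fin G.m) × List (Fin F.m)) := R1.toList ++ R2.toList.map Prod.swap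
    have hl : ∀ q ∈ l, q.1 ≠ [] ∧ q.2 ≠ [] := by
      intro q hq
      rcases List.mem_append.1 hq with hq | hq
      · exact hR1 q (Finset.mem_toList.1 hq)
      · obtain ⟨p, hp, rfl⟩ := List.mem_map.1 hq
        exact (hR2 p (Finset.mem_toList.1 hp)).symm
    have hl1 : ∀ q ∈ R1, ∃ k : Fin l.length, l.get k = q := fun q hq =>
      List.get_of_mem (List.mem_append.2 (Or.inl (Finset.mem_toList.2 hq)))
    have hl2 : ∀ q ∈ R2, ∃ k : Fin l.length, l.get k = q.swap := fun q hq =>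
      List.get_of_mem (List.mem_append.2 (Or.inr (List.mem_map.2 ⟨q, Finset.mem_toList.2 hq, rfl⟩)))
    obtain ⟨Ms, hMs⟩ : ∃ Ms, Ms = Finset.univ.sup
      (fun k : Fin l.length => max (l.get k).1.length (l.get k).2.length) := ⟨_, rfl⟩
    obtain ⟨M1, hM1⟩ := h1 (Ms + 1)
    obtain ⟨M2, hM2⟩ := h2 (Ms + 1)
    have hK : 1 ≤ l.length := by
      obtain ⟨u, -, q, hq, -⟩ := hM1 (List.replicate M1 ⟨0, G.hm⟩) (by simp)
      obtain ⟨k, -⟩ := hl1 q hq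
      exact Nat.succ_le_of_lt (k.pos)
    refine ⟨l.length, hK, fun k => (l.get k).1, fun k => (l.get k).2, max (Ms + 1) (max M1 M2),
      fun k => hl _ (List.get_mem l k), ?_, ?_, ?_⟩
    · rw [← hMs]; exact le_max_left _ _
    · rw [← hMs]
      intro x hx t ht
      obtain ⟨u, hu, q, hq, hall⟩ := hM1 t (by omega)
      obtain ⟨k, rfl⟩ := hl1 q hq
      refine ⟨u, k, hu, fun z hz => ?_⟩
      obtain ⟨y, hy, e⟩ := hall z hz.2
      exact ⟨y, hVF.2.2.1 hy, e⟩
    · rw [← hMs]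
      intro x hx t ht
      obtain ⟨u, hu, q, hq, hall⟩ := hM2 t (by omega)
      obtain ⟨k, hk⟩ := hl2 q hq
      refine ⟨u, k, hu, fun z hz => ?_⟩
      obtain ⟨y, hy, e⟩ := hall z hz.2
      refine ⟨y, hVG.2.2.1 hy, ?_⟩
      beta_reduce
      rw [hk]
      exact e
  · rintro ⟨VG, VF, hVG, hVF, K, -, tk, uk, M, -, -, h1, h2⟩
    have hle : ∀ k, max (tk k).length (uk k).length ≤
        Finset.univ.sup (fun k => max (tk k).length (uk k).length) := fun k =>
      Finset.le_sup (f := fun k => max (tk k).length (uk k).length) (Finset.mem_univ k)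
    exact Set.Subset.antisymm
      (HolIFS.sub_of_side hAg hAf hVG hVF (fun k => (le_max_right _ _).trans (hle k)) h1)
      (HolIFS.sub_of_side hAf hAg hVF hVG (fun k => (le_max_left _ _).trans (hle k)) h2)
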